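/- arXiv:math/0307248 — 3 statements merged into one kernel-verified Lean document; each statement's English description precedes it below -/
import Mathlib

section
/- Suppose θ is inner and N-regular, and let (e,h,f) be a regular θ-adapted sl2-triple. Then dim g_0 = (1/m) · ( dim g + Σ_{i=0}^{m−1} (m − 1 − 2i) · k_i ), where the indices i ∈ {0,1,…,m−1} are taken as representatives of ℤ/mℤ. -/
open LieAlgebra Module

variable (k : Type*) [Field k] [IsAlgClosed k] [CharZero k]
variable (g : Type*) [LieRing g] [LieAlgebra k g] [FiniteDimensional k g]
  [LieAlgebra.IsSemisimple k g]

/-- The `ζ^i`-eigenspace of the automorphism `θ`, i.e. the graded piece `g_i`. -/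
noncomputable def gradePiece {m : ℕ} (ζ : k) (θ : g ≃ₗ[k] g) (i : ZMod m) : Submodule k g :=
  Module.End.eigenspace (θ : g →ₗ[k] g) (ζ ^ i.val)

/-- The centraliser `z(x) = {y : ⁅x, y⁆ = 0}` of `x`. -/
noncomputable def zc (x : g) : Submodule k g := LinearMap.ker (LieAlgebra.ad k g x)

/-- Truncated exponential of an endomorphism; it agrees with the exponential series for
nilpotent endomorphisms of a finite-dimensional space. -/
noncomputable def expEnd (N : Module.End k g) : Module.End k g :=
  ∑ i ∈ Finset.range (Module.finrank k g + 1), ((i.factorial : k))⁻¹ • N ^ i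

/-- The group `Int g` of inner automorphisms: the subgroup of the automorphism group
generated by `exp (ad n)` for `n` with `ad n` nilpotent. -/
noncomputable def IntG : Subgroup (g ≃ₗ[k] g) :=
  Subgroup.closure {τ | ∃ n : g, IsNilpotent (LieAlgebra.ad k g n) ∧
    (τ : g →ₗ[k] g) = expEnd k g (LieAlgebra.ad k g n)}

/-- A Cartan subspace of `g_1`: a commutative subspace consisting of semisimple elements,
maximal among subspaces of `g_1` with these two properties. -/
def IsCartanSubspace (m : ℕ) (ζ : k) (θ : g ≃ₗ[k] g) (c : Submodule k g) : Prop :=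
  c ≤ gradePiece k g ζ θ (1 : ZMod m) ∧
  (∀ x ∈ c, ∀ y ∈ c, ⁅x, y⁆ = 0) ∧
  (∀ x ∈ c, (LieAlgebra.ad k g x).IsSemisimple) ∧
  ∀ c' : Submodule k g, c' ≤ gradePiece k g ζ θ (1 : ZMod m) →
    (∀ x ∈ c', ∀ y ∈ c', ⁅x, y⁆ = 0) → (∀ x ∈ c', (LieAlgebra.ad k g x).IsSemisimple) →
    c ≤ c' → c = c'

/-- Polynomial functions on `g`: functions arising from the symmetric algebra of `g*`. -/
def IsPolyFun (F : g → k) : Prop :=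
  ∃ p : MvPolynomial (Module.Dual k g) k, ∀ x, F x = MvPolynomial.eval (fun φ => φ x) p

/-- The number `k_i = Σ_{c ∈ ℤ, c ≡ i (mod m)} dim {v ∈ z(e) : ⁅h, v⁆ = 2c • v}`. -/
noncomputable def kNum (m : ℕ) (e h : g) (i : ZMod m) : ℕ :=
  ∑ᶠ c : ℤ, if ((c : ZMod m) = i) then
    Module.finrank k ↥(zc k g e ⊓ Module.End.eigenspace (LieAlgebra.ad k g h) (2 * (c : k)))
  else 0

set_option linter.unusedSectionVars false

/-! ### Part A: ranks and minors over a field -/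

theorem minor_eq_zero_of_rank_lt {F : Type*} [Field F] {n : Type*} [Fintype n] [DecidableEq n]
    {s : ℕ} (M : Matrix n n F) (hM : M.rank < s)
    (P : Matrix (Fin s) n F) (Q : Matrix n (Fin s) F) : (P * M * Q).det = 0 := by
  by_contra hne
  have h1 : (P * M * Q).rank = s := by
    rw [Matrix.rank_of_isUnit _ ((Matrix.isUnit_iff_isUnit_det _).2 (isUnit_iff_ne_zero.2 hne))]
    simp
  have h2 := Matrix.rank_mul_le_left (P * M) Q
  have h3 := Matrix.rank_mul_le_right P M
  omega

theorem rank_lt_of_minor_eq_zero {F : Type*} [Field F] {n : Type*} [Fintype n] [DecidableEq n]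
    {s : ℕ} (M : Matrix n n F)
    (h : ∀ (P : Matrix (Fin s) n F) (Q : Matrix n (Fin s) F), (P * M * Q).det = 0) :
    M.rank < s := by
  by_contra hlt
  push Not at hlt
  obtain ⟨w, hw⟩ : ∃ w : Fin s → LinearMap.range M.mulVecLin, LinearIndependent F w :=
    exists_linearIndependent_of_le_finrank hlt
  choose q hq using fun i => (w i).2
  have hw' : LinearIndependent F (fun i => (w i : n → F)) :=
    hw.map' (Submodule.subtype _) (Submodule.ker_subtype _)
  let Q : Matrix n (Fin s) F := Matrix.of fun a i => q i a
  have hMQ : (M * Q).col = fun i => (w i : n → F) := by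
    funext i a
    rw [← hq i]
    rfl
  obtain ⟨P, hP⟩ : ∃ P : Matrix (Fin s) n F, P * (M * Q) = 1 := by
    have : Function.Injective (M * Q).mulVec := by
      rw [Matrix.mulVec_injective_iff, hMQ]; exact hw'
    obtain ⟨p, hp⟩ := LinearMap.exists_leftInverse_of_injective (Matrix.mulVecLin (M * Q))
      (LinearMap.ker_eq_bot.2 this)
    refine ⟨LinearMap.toMatrix' p, ?_⟩
    have h2 := congrArg LinearMap.toMatrix' hp
    rwa [LinearMap.toMatrix'_comp, LinearMap.toMatrix'_id, ← Matrix.toLin'_apply', LinearMap.toMatrix'_toLin'] at h2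
  have := h P Q
  rw [Matrix.mul_assoc, hP] at this
  simp at this

/-! ### Part B: generic rank of the adjoint representation -/

theorem isCartan_engel_of_regular (x : g) (hx : LieAlgebra.IsRegular k x) :
    (LieSubalgebra.engel k x).IsCartanSubalgebra := by
  refine ⟨?_, LieSubalgebra.normalizer_engel _ _⟩
  apply LieSubalgebra.isNilpotent_of_forall_le_engel
  intro y hy
  have hc : (finrank k g : Cardinal) ≤ Cardinal.mk k :=
    Cardinal.natCast_le_aleph0.trans <| Cardinal.infinite_iff.mp inferInstance
  set Ex : {LieSubalgebra.engel k z | z ∈ LieSubalgebra.engel k x} :=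
    ⟨LieSubalgebra.engel k x, x, LieSubalgebra.self_mem_engel _ _, rfl⟩
  suffices IsBot Ex from @this ⟨LieSubalgebra.engel k y, y, hy, rfl⟩
  apply LieAlgebra.engel_isBot_of_isMin hc (LieSubalgebra.engel k x) Ex le_rfl
  rintro ⟨_, y, hy, rfl⟩ hyx
  suffices finrank k (LieSubalgebra.engel k x) ≤ finrank k (LieSubalgebra.engel k y) by
    suffices LieSubalgebra.engel k y = LieSubalgebra.engel k x from this.ge
    apply LieSubalgebra.toSubmodule_injective
    exact Submodule.eq_of_le_of_finrank_le hyx this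
  rw [(LieAlgebra.isRegular_iff_finrank_engel_eq_rank k x).mp hx]
  apply LieAlgebra.rank_le_finrank_engel

theorem rank_le_ker_of_regular (x : g) (hx : LieAlgebra.IsRegular k x) :
    LieAlgebra.rank k g ≤ finrank k (LinearMap.ker (ad k g x)) := by
  have := isCartan_engel_of_regular k g x hx
  rw [← (LieAlgebra.isRegular_iff_finrank_engel_eq_rank k x).mp hx]
  apply Submodule.finrank_mono (s := (LieSubalgebra.engel k x).toSubmodule)
  intro y hy
  have h1 : IsLieAbelian (LieSubalgebra.engel k x) := inferInstance
  have h2 := h1.trivial ⟨x, LieSubalgebra.self_mem_engel k x⟩ ⟨y, hy⟩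
  have h3 := congrArg Subtype.val h2
  simpa using h3

theorem finrank_ker_add_rank_toMatrix {ι : Type*} [Fintype ι] [DecidableEq ι] (b : Basis ι k g)
    (u : Module.End k g) :
    finrank k (LinearMap.ker u) + (LinearMap.toMatrix b b u).rank = finrank k g := by
  rw [Matrix.rank_eq_finrank_range_toLin _ b b, Matrix.toLin_toMatrix, add_comm]
  exact LinearMap.finrank_range_add_finrank_ker u

/-- matrices of `ad (b i)` -/
noncomputable def adM {ι : Type*} [Fintype ι] [DecidableEq ι] (b : Basis ι k g) (i : ι) :
    Matrix ι ι k := LinearMap.toMatrix b b (ad k g (b i))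

theorem sum_adM {ι : Type*} [Fintype ι] [DecidableEq ι] (b : Basis ι k g) (c : ι → k) :
    ∑ i, c i • adM k g b i = LinearMap.toMatrix b b (ad k g (∑ i, c i • b i)) := by
  simp [adM, map_sum]

/-- The generic minor. -/
noncomputable def genDet {ι : Type*} [Fintype ι] [DecidableEq ι] (b : Basis ι k g) {s : ℕ}
    (P : Matrix (Fin s) ι k) (Q : Matrix ι (Fin s) k)
    {R : Type*} [CommRing R] [Algebra k R] (z : ι ⊕ ι × ι → R) : R :=
  (P.map (algebraMap k R) * ((∑ i, z (.inl i) • (adM k g b i).map (algebraMap k R)) *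
    Matrix.of fun i j => z (.inr (i, j))) * Q.map (algebraMap k R)).det

theorem map_genDet {ι : Type*} [Fintype ι] [DecidableEq ι] (b : Basis ι k g) {s : ℕ}
    (P : Matrix (Fin s) ι k) (Q : Matrix ι (Fin s) k)
    {R : Type*} [CommRing R] [Algebra k R] {R' : Type*} [CommRing R'] [Algebra k R']
    (φ : R →ₐ[k] R') (z : ι ⊕ ι × ι → R) :
    φ (genDet k g b P Q z) = genDet k g b P Q (fun i => φ (z i)) := by
  rw [genDet, AlgHom.map_det, genDet]
  congr 1
  ext i j
  simp [Matrix.mul_apply, Matrix.sum_apply]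

theorem genDet_eq_zero_of_regular {ι : Type*} [Fintype ι] [DecidableEq ι] (b : Basis ι k g) {s : ℕ}
    (hs : finrank k g < s + LieAlgebra.rank k g)
    (P : Matrix (Fin s) ι k) (Q : Matrix ι (Fin s) k) (z : ι ⊕ ι × ι → k)
    (hz : LieAlgebra.IsRegular k (∑ i, z (.inl i) • b i)) : genDet k g b P Q z = 0 := by
  apply minor_eq_zero_of_rank_lt
  refine (Matrix.rank_mul_le_left _ _).trans_lt ?_
  have h0 := sum_adM k g b (fun i => z (.inl i))
  have h1 := rank_le_ker_of_regular k g _ hz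
  have h2 := finrank_ker_add_rank_toMatrix k g b (ad k g (∑ i, z (.inl i) • b i))
  rw [← h0] at h2
  have h3 : ∀ i, (adM k g b i).map (algebraMap k k) = adM k g b i := by
    intro i; ext; simp
  simp only [h3]
  omega

theorem genDet_eq_zero {ι : Type*} [Fintype ι] [DecidableEq ι] (b : Basis ι k g) {s : ℕ}
    (hs : finrank k g < s + LieAlgebra.rank k g)
    (P : Matrix (Fin s) ι k) (Q : Matrix ι (Fin s) k)
    {R : Type*} [CommRing R] [Algebra k R] (z : ι ⊕ ι × ι → R) : genDet k g b P Q z = 0 := by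
  let f : MvPolynomial (ι ⊕ ι × ι) k := genDet k g b P Q MvPolynomial.X
  obtain ⟨q, hq, hqr⟩ : ∃ q : MvPolynomial ι k, q ≠ 0 ∧
      ∀ x, LieAlgebra.IsRegular k x ↔ MvPolynomial.eval (b.repr x) q ≠ 0 :=
    ⟨_, LieAlgebra.polyCharpoly_coeff_rank_ne_zero k g b,
      fun x => LieAlgebra.isRegular_iff_coeff_polyCharpoly_rank_ne_zero k b x⟩
  let q' : MvPolynomial (ι ⊕ ι × ι) k := MvPolynomial.rename Sum.inl q
  have hq' : q' ≠ 0 := by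
    intro h0
    apply hq
    apply MvPolynomial.rename_injective (Sum.inl : ι → ι ⊕ ι × ι) Sum.inl_injective
    rw [map_zero]; exact h0
  have hfq : f * q' = 0 := by
    apply MvPolynomial.funext
    intro z
    rw [map_mul, map_zero, mul_eq_zero]
    by_cases hz : LieAlgebra.IsRegular k (∑ i, z (.inl i) • b i)
    · left
      have h1 : MvPolynomial.aeval z f = genDet k g b P Q z := by
        rw [map_genDet]; simp
      rw [← MvPolynomial.coe_aeval_eq_eval]
      exact h1.trans (genDet_eq_zero_of_regular k g b hs P Q z hz)
    · right
      rw [hqr, not_not] at hz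
      rw [MvPolynomial.eval_rename]
      have hcoe : z ∘ Sum.inl = ⇑(b.repr (∑ i, z (Sum.inl i) • b i)) := by
        ext i
        simp [Finsupp.single_apply]
      rw [hcoe]
      exact hz
  have hf : f = 0 := (mul_eq_zero.1 hfq).resolve_right hq'
  have h1 : MvPolynomial.aeval z f = genDet k g b P Q z := by
    rw [map_genDet]; simp
  rw [← h1, hf, map_zero]

theorem generic_minor {ι : Type*} [Fintype ι] [DecidableEq ι] (b : Basis ι k g) {s : ℕ}
    (hs : finrank k g < s + LieAlgebra.rank k g)
    {R : Type*} [CommRing R] [Algebra k R] (c : ι → R) (W : Matrix ι ι R)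
    (P : Matrix (Fin s) ι k) (Q : Matrix ι (Fin s) k) :
    (P.map (algebraMap k R) * ((∑ i, c i • (adM k g b i).map (algebraMap k R)) * W)
      * Q.map (algebraMap k R)).det = 0 :=
  genDet_eq_zero k g b hs P Q (Sum.elim c fun ij => W ij.1 ij.2)

/-! ### Part C: the logarithm of a unipotent automorphism is a derivation -/

/-- The polynomial `binom(X, j)`. -/
noncomputable def binPoly (j : ℕ) : Polynomial k :=
  Polynomial.C ((j.factorial : k)⁻¹) * descPochhammer k j

/-- Linear coefficient of `binom(X, j)`. -/
noncomputable def lc (j : ℕ) : k := (binPoly k j).coeff 1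

theorem binPoly_eval (j s : ℕ) : (binPoly k j).eval (s : k) = (s.choose j : k) := by
  rw [binPoly, Polynomial.eval_mul, Polynomial.eval_C, descPochhammer_eval_eq_descFactorial,
    Nat.descFactorial_eq_factorial_mul_choose]
  have : (j.factorial : k) ≠ 0 := by exact_mod_cast j.factorial_ne_zero
  push_cast
  field_simp

theorem binPoly_coeff_zero (j : ℕ) : (binPoly k j).coeff 0 = if j = 0 then 1 else 0 := by
  rw [Polynomial.coeff_zero_eq_eval_zero]
  have := binPoly_eval k j 0
  rw [Nat.cast_zero] at this
  rw [this]
  cases j <;> simp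

theorem lc_zero : lc k 0 = 0 := by
  simp [lc, binPoly, Polynomial.coeff_one]

theorem lc_one : lc k 1 = 1 := by
  simp [lc, binPoly]

theorem poly_family_zero {V : Type*} [AddCommGroup V] [Module k V] {Q : Type*} (S : Finset Q)
    (p : Q → Polynomial k) (w : Q → V)
    (h : ∀ s : ℕ, ∑ q ∈ S, (p q).eval (s : k) • w q = 0) (n : ℕ) :
    ∑ q ∈ S, (p q).coeff n • w q = 0 := by
  rw [← Module.forall_dual_apply_eq_zero_iff k]
  intro φ
  have hp : ∑ q ∈ S, Polynomial.C (φ (w q)) * p q = 0 := by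
    apply Polynomial.eq_zero_of_infinite_isRoot
    apply Set.Infinite.mono (s := Set.range (fun s : ℕ => (s : k)))
    · rintro _ ⟨s, rfl⟩
      have := congrArg φ (h s)
      simp only [map_sum, map_smul, smul_eq_mul, map_zero] at this
      simp only [Set.mem_ofPred_eq, Polynomial.IsRoot.def, Polynomial.eval_finsetSum,
        Polynomial.eval_mul, Polynomial.eval_C]
      rw [← this]
      exact Finset.sum_congr rfl fun _ _ => mul_comm _ _
    · exact Set.infinite_range_of_injective Nat.cast_injective
  have := congrArg (fun r => Polynomial.coeff r n) hp
  simp only [Polynomial.finsetSum_coeff, Polynomial.coeff_C_mul, Polynomial.coeff_zero] at this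
  simp only [map_sum, map_smul, smul_eq_mul]
  rw [← this]
  exact Finset.sum_congr rfl fun _ _ => mul_comm _ _

theorem one_add_pow_eq {E : Type*} [Ring E] [Algebra k E] (A : E) (M : ℕ) (hA : A ^ M = 0)
    (s : ℕ) : (1 + A) ^ s = ∑ j ∈ Finset.range M, (binPoly k j).eval (s : k) • A ^ j := by
  simp only [binPoly_eval]
  rw [add_comm, (Commute.one_right A).add_pow]
  simp only [one_pow, mul_one]
  have h1 : ∑ j ∈ Finset.range (s + 1), A ^ j * (s.choose j : E)
      = ∑ j ∈ Finset.range (max M (s + 1)), (s.choose j : k) • A ^ j := by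
    rw [← Finset.sum_subset (Finset.range_mono (le_max_right M (s + 1)))]
    · refine Finset.sum_congr rfl fun j _ => ?_
      rw [Algebra.smul_def, map_natCast, Nat.cast_comm]
    · intro j _ hj
      rw [Nat.choose_eq_zero_of_lt (by simpa using hj)]
      simp
  rw [h1]
  symm
  apply Finset.sum_subset (Finset.range_mono (le_max_left M (s + 1)))
  intro j _ hj
  rw [pow_eq_zero_of_le (by simpa using hj) hA, smul_zero]

theorem log_derivation {V : Type*} [AddCommGroup V] [Module k V]
    (β : V →ₗ[k] V →ₗ[k] V) (A : Module.End k V) (M : ℕ) (hM : 0 < M) (hA : A ^ M = 0)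
    (hT : ∀ x y, (1 + A) (β x y) = β ((1 + A) x) ((1 + A) y)) (x y : V) :
    (∑ j ∈ Finset.range M, lc k j • A ^ j) (β x y) =
      β ((∑ j ∈ Finset.range M, lc k j • A ^ j) x) y +
      β x ((∑ j ∈ Finset.range M, lc k j • A ^ j) y) := by
  have hpow : ∀ s : ℕ, ((1 + A) ^ s) (β x y) = β (((1 + A) ^ s) x) (((1 + A) ^ s) y) := by
    intro s
    induction s with
    | zero => simp
    | succ s ih => simp only [pow_succ', Module.End.mul_apply, ih, hT]
  simp only [one_add_pow_eq k A M hA] at hpow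
  have h0 := poly_family_zero k (Q := ℕ ⊕ ℕ × ℕ)
    ((Finset.range M).disjSum (Finset.range M ×ˢ Finset.range M))
    (Sum.elim (binPoly k) (fun jl => binPoly k jl.1 * binPoly k jl.2))
    (Sum.elim (fun j => (A ^ j) (β x y)) (fun jl => - β ((A ^ jl.1) x) ((A ^ jl.2) y)))
    (by
      intro s
      have := hpow s
      rw [Finset.sum_disjSum]
      simp only [Sum.elim_inl, Sum.elim_inr, smul_neg, Finset.sum_neg_distrib]
      rw [add_neg_eq_zero, Finset.sum_product]
      simp only [LinearMap.sum_apply, LinearMap.smul_apply, map_sum, map_smul,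
        Polynomial.eval_mul] at this ⊢
      rw [this]
      simp only [mul_smul, Finset.smul_sum]
      rw [Finset.sum_comm]
      refine Finset.sum_congr rfl fun i _ => Finset.sum_congr rfl fun j _ => ?_
      rw [smul_comm]) 1
  rw [Finset.sum_disjSum] at h0
  simp only [Sum.elim_inl, Sum.elim_inr, smul_neg, Finset.sum_neg_distrib] at h0
  rw [add_neg_eq_zero, Finset.sum_product] at h0
  simp only [LinearMap.sum_apply, LinearMap.smul_apply, map_sum, map_smul]
  refine h0.trans ?_
  have hc : ∀ j l, (binPoly k j * binPoly k l).coeff 1 =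
      (if j = 0 then lc k l else 0) + (if l = 0 then lc k j else 0) := by
    intro j l
    rw [Polynomial.coeff_mul, Finset.Nat.antidiagonal_succ]
    simp [binPoly_coeff_zero, lc]
  simp only [hc, add_smul, Finset.sum_add_distrib, ite_smul, zero_smul]
  rw [add_comm]
  congr 1
  · refine Finset.sum_congr rfl fun i _ => ?_
    rw [Finset.sum_ite_eq' (Finset.range M) 0]
    simp [hM]
  · rw [Finset.sum_comm]
    refine Finset.sum_congr rfl fun i _ => ?_
    rw [Finset.sum_ite_eq' (Finset.range M) 0]
    simp [hM]

/-! ### Part D: unipotent automorphisms over a finite `k`-algebra -/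

/-- The matrix of `ad u` for `u` a coordinate vector over a `k`-algebra `R`. -/
noncomputable def adR {ι : Type*} [Fintype ι] [DecidableEq ι] (b : Basis ι k g)
    {R : Type*} [CommRing R] [Algebra k R] (u : ι → R) : Matrix ι ι R :=
  ∑ i, u i • (adM k g b i).map (algebraMap k R)

section
variable {ι : Type*} [Fintype ι] [DecidableEq ι] (b : Basis ι k g)
  {R : Type*} [CommRing R] [Algebra k R]

theorem adR_apply (u : ι → R) (a c : ι) :
    adR k g b u a c = ∑ i, u i * algebraMap k R (adM k g b i a c) := by
  simp [adR, Matrix.sum_apply]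

theorem adR_add (u v : ι → R) : adR k g b (u + v) = adR k g b u + adR k g b v := by
  simp [adR, add_smul, Finset.sum_add_distrib]

theorem adR_smul (r : R) (u : ι → R) : adR k g b (r • u) = r • adR k g b u := by
  simp [adR, Finset.smul_sum, mul_smul]

theorem adR_sum {Q : Type*} (S : Finset Q) (u : Q → ι → R) :
    adR k g b (∑ q ∈ S, u q) = ∑ q ∈ S, adR k g b (u q) := by
  classical
  induction S using Finset.induction_on with
  | empty => simp [adR]
  | insert a S ha ih => rw [Finset.sum_insert ha, Finset.sum_insert ha, adR_add, ih]

theorem adR_map {R' : Type*} [CommRing R'] [Algebra k R'] (φ : R →ₐ[k] R') (u : ι → R) :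
    adR k g b (fun i => φ (u i)) = (adR k g b u).map φ := by
  ext a c
  simp [adR_apply]

theorem adR_repr (x : g) : adR k g b (b.repr x : ι → k) = LinearMap.toMatrix b b (ad k g x) := by
  have h := sum_adM k g b (b.repr x)
  rw [b.sum_repr] at h
  rw [← h, adR]
  refine Finset.sum_congr rfl fun i _ => ?_
  congr 1

theorem adR_repr_mulVec (x y : g) :
    Matrix.mulVec (adR k g b (b.repr x : ι → k)) (b.repr y) = b.repr ⁅x, y⁆ := by
  rw [adR_repr, LinearMap.toMatrix_mulVec_repr, LieAlgebra.ad_apply]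

/-- The bracket as a `k`-bilinear map on coordinate vectors. -/
noncomputable def brL : (ι → R) →ₗ[k] (ι → R) →ₗ[k] (ι → R) :=
  LinearMap.mk₂ k (fun u v => Matrix.mulVec (adR k g b u) v)
    (fun u v w => by rw [adR_add, Matrix.add_mulVec])
    (fun c u v => by
      have : c • u = (algebraMap k R c) • u := by ext; simp [Algebra.smul_def]
      rw [this, adR_smul, Matrix.smul_mulVec]
      ext; simp [Algebra.smul_def])
    (fun u v w => by rw [Matrix.mulVec_add])
    (fun c u v => by rw [Matrix.mulVec_smul])

theorem matrix_log_derivation (A : Matrix ι ι R) (M : ℕ) (hM : 0 < M) (hA : A ^ M = 0)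
    (hT : ∀ u v, (1 + A).mulVec ((adR k g b u).mulVec v) =
      (adR k g b ((1 + A).mulVec u)).mulVec ((1 + A).mulVec v)) (u v : ι → R) :
    (∑ j ∈ Finset.range M, lc k j • A ^ j).mulVec ((adR k g b u).mulVec v) =
      (adR k g b ((∑ j ∈ Finset.range M, lc k j • A ^ j).mulVec u)).mulVec v +
      (adR k g b u).mulVec ((∑ j ∈ Finset.range M, lc k j • A ^ j).mulVec v) := by
  let A' : Module.End k (ι → R) := (Matrix.mulVecLin A).restrictScalars k
  have hpow : ∀ j (w : ι → R), (A' ^ j) w = (A ^ j).mulVec w := by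
    intro j
    induction j with
    | zero => intro w; simp
    | succ j ih =>
      intro w
      rw [pow_succ', Module.End.mul_apply, ih, pow_succ', ← Matrix.mulVec_mulVec]
      rfl
  have h1 : ∀ w, (1 + A') w = (1 + A).mulVec w := by
    intro w
    rw [Matrix.add_mulVec, Matrix.one_mulVec]; rfl
  have hD : ∀ w, (∑ j ∈ Finset.range M, lc k j • A' ^ j) w =
      (∑ j ∈ Finset.range M, lc k j • A ^ j).mulVec w := by
    intro w
    simp [LinearMap.sum_apply, hpow, Matrix.sum_mulVec, Matrix.smul_mulVec]
  have := log_derivation k (brL k g b (R := R)) A' M hM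
    (LinearMap.ext fun w => by rw [hpow, hA]; simp) (fun x y => by rw [h1, h1, h1]; exact hT x y) u v
  rw [hD, hD, hD] at this
  exact this

theorem derivation_inner_field (D : Matrix ι ι k)
    (hD : ∀ u v : ι → k, D.mulVec ((adR k g b u).mulVec v) =
      (adR k g b (D.mulVec u)).mulVec v + (adR k g b u).mulVec (D.mulVec v)) :
    ∃ x : ι → k, D = adR k g b x := by
  let Dg : g →ₗ[k] g := Matrix.toLin b b D
  have hr : ∀ x, (b.repr (Dg x) : ι → k) = D.mulVec (b.repr x) := by
    intro x
    have := LinearMap.toMatrix_mulVec_repr b b Dg x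
    rw [← this, LinearMap.toMatrix_toLin]
  have hl : ∀ x y, Dg ⁅x, y⁆ = ⁅Dg x, y⁆ + ⁅x, Dg y⁆ := by
    intro x y
    apply b.repr.injective
    apply DFunLike.coe_injective
    rw [hr, ← adR_repr_mulVec, hD, map_add, Finsupp.coe_add, ← adR_repr_mulVec, ← adR_repr_mulVec,
      hr, hr]
  let L : LieDerivation k g g := ⟨Dg, fun x y => by
    rw [hl, ← lie_skew y (Dg x)]; abel⟩
  obtain ⟨x, hx⟩ := LieDerivation.IsKilling.exists_eq_ad L
  refine ⟨b.repr x, ?_⟩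
  rw [adR_repr]
  have h2 : Dg = ad k g x := by
    ext y
    have := DFunLike.congr_fun hx y
    exact (this.symm.trans (LinearMap.congr_fun (LieDerivation.coe_ad_apply_eq_ad_apply x) y))
  rw [← h2, LinearMap.toMatrix_toLin]

theorem derivation_inner [Module.Finite k R] (D : Matrix ι ι R)
    (hD : ∀ u v : ι → R, D.mulVec ((adR k g b u).mulVec v) =
      (adR k g b (D.mulVec u)).mulVec v + (adR k g b u).mulVec (D.mulVec v)) :
    ∃ x : ι → R, D = adR k g b x := by
  have h1 : ∀ φ : R →ₗ[k] k, ∃ x : ι → k, D.map φ = adR k g b x := by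
    intro φ
    apply derivation_inner_field
    intro u v
    have hmv : ∀ (D : Matrix ι ι R) (w : ι → k) (i : ι),
        φ ((D.mulVec (fun i => algebraMap k R (w i))) i) = ((D.map φ).mulVec w) i := by
      intro D w i
      simp only [Matrix.mulVec, dotProduct, map_sum, Matrix.map_apply]
      refine Finset.sum_congr rfl fun j _ => ?_
      rw [mul_comm, ← Algebra.smul_def, map_smul, smul_eq_mul, mul_comm]
    have had : ∀ z : ι → R, (adR k g b z).map φ = adR k g b (fun i => φ (z i)) := by
      intro z
      ext a c
      simp only [Matrix.map_apply, adR_apply, map_sum, Algebra.algebraMap_self, RingHom.id_apply]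
      refine Finset.sum_congr rfl fun j _ => ?_
      rw [mul_comm, ← Algebra.smul_def, map_smul, smul_eq_mul, mul_comm]
    have hc : ∀ w : ι → k, (adR k g b (fun i => algebraMap k R (w i)))
        = (adR k g b w).map (algebraMap k R) := fun w => adR_map k g b (Algebra.ofId k R) w
    have hcm : ∀ (C : Matrix ι ι k) (w : ι → k),
        (C.map (algebraMap k R)).mulVec (fun i => algebraMap k R (w i)) =
          fun i => algebraMap k R (C.mulVec w i) := by
      intro C w
      ext i
      simp [Matrix.mulVec, dotProduct]
    have hcz : ∀ (C : Matrix ι ι k) (z : ι → R) (i : ι),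
        φ ((C.map (algebraMap k R)).mulVec z i) = C.mulVec (fun i => φ (z i)) i := by
      intro C z i
      simp only [Matrix.mulVec, dotProduct, map_sum, Matrix.map_apply]
      refine Finset.sum_congr rfl fun j _ => ?_
      rw [← Algebra.smul_def, map_smul, smul_eq_mul]
    have := hD (fun i => algebraMap k R (u i)) (fun i => algebraMap k R (v i))
    ext i
    have h2 := congrArg (fun w => φ (w i)) this
    simp only [Pi.add_apply, map_add] at h2
    rw [hc, hcm, hmv, hmv, had, hcz] at h2
    rw [h2, Pi.add_apply]
    congr 2
    · congr 1
      congr 1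
      ext j
      exact hmv D u j
    · congr 1
      ext j
      exact hmv D v j
  choose x hx using h1
  let β := Module.finBasis k R
  refine ⟨∑ q, β q • fun i => algebraMap k R (x (β.coord q) i), ?_⟩
  rw [adR_sum]
  ext a c
  rw [Matrix.sum_apply]
  have h3 : ∀ q, adR k g b (β q • fun i => algebraMap k R (x (β.coord q) i)) a c
      = β.coord q (D a c) • β q := by
    intro q
    have hc : (adR k g b (fun i => algebraMap k R (x (β.coord q) i)))
        = (adR k g b (x (β.coord q))).map (algebraMap k R) :=
      adR_map k g b (Algebra.ofId k R) _
    rw [adR_smul, hc, ← hx]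
    simp [Algebra.smul_def, mul_comm]
  simp only [h3]
  exact (β.sum_repr (D a c)).symm

theorem minor_unipotent [Module.Finite k R] (A : Matrix ι ι R) (M : ℕ) (hA : A ^ M = 0)
    (hT : ∀ u v, (1 + A).mulVec ((adR k g b u).mulVec v) =
      (adR k g b ((1 + A).mulVec u)).mulVec ((1 + A).mulVec v))
    {s : ℕ} (hs : finrank k g < s + LieAlgebra.rank k g)
    (P : Matrix (Fin s) ι k) (Q : Matrix ι (Fin s) k) :
    (P.map (algebraMap k R) * A * Q.map (algebraMap k R)).det = 0 := by
  have hA2 : A ^ (M + 2) = 0 := by rw [pow_add, hA, zero_mul]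
  obtain ⟨x, hx⟩ := derivation_inner k g b (∑ j ∈ Finset.range (M + 2), lc k j • A ^ j)
    (matrix_log_derivation k g b A (M + 2) (by omega) hA2 hT)
  -- factor `D = A * U` with `U` a unit
  let N : Matrix ι ι R := ∑ j ∈ Finset.range M, lc k (j + 2) • A ^ (j + 1)
  have hN : ∑ j ∈ Finset.range (M + 2), lc k j • A ^ j = A * (1 + N) := by
    rw [Finset.sum_range_succ', Finset.sum_range_succ', lc_zero]
    simp only [zero_add, lc_one, pow_one, one_smul, zero_smul, add_zero, N, mul_add, mul_one]
    rw [add_comm, Finset.mul_sum]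
    congr 1
    refine Finset.sum_congr rfl fun j _ => ?_
    rw [Matrix.mul_smul, ← pow_succ']
  have hNn : IsNilpotent N := by
    have : N = A * ∑ j ∈ Finset.range M, lc k (j + 2) • A ^ j := by
      rw [Finset.mul_sum]
      refine Finset.sum_congr rfl fun j _ => ?_
      rw [Matrix.mul_smul, ← pow_succ']
    rw [this]
    apply Commute.isNilpotent_mul_right _ ⟨M, hA⟩
    apply Commute.sum_right
    intro j _
    exact ((Commute.refl A).pow_right j).smul_right _
  obtain ⟨U, hU⟩ := hNn.isUnit_one_add
  have hA3 : A = adR k g b x * (↑U⁻¹ : Matrix ι ι R) := by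
    rw [← hx, hN, ← hU, mul_assoc, Units.mul_inv, mul_one]
  rw [hA3]
  exact generic_minor k g b hs x _ P Q

end

/-! ### Part E: polynomial families of automorphisms -/

section
open Polynomial
variable {ι : Type*} [Fintype ι] [DecidableEq ι] (b : Basis ι k g)

/-- The matrix `T` scales the bracket by `δ`. -/
def BrScale {R : Type*} [CommRing R] [Algebra k R] (δ : R) (T : Matrix ι ι R) : Prop :=
  ∀ u : ι → R, δ • (T * adR k g b u) = adR k g b (T.mulVec u) * T

theorem brScale_of_basis {R : Type*} [CommRing R] [Algebra k R] (δ : R) (T : Matrix ι ι R)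
    (h : ∀ i, δ • (T * (adM k g b i).map (algebraMap k R)) = adR k g b (fun a => T a i) * T) :
    BrScale k g b δ T := by
  intro u
  have h1 : T.mulVec u = ∑ i, u i • (fun a => T a i) := by
    ext a
    simp [Matrix.mulVec, dotProduct, mul_comm]
  rw [h1, adR_sum, Finset.sum_mul]
  conv_lhs => rw [adR, Finset.mul_sum, Finset.smul_sum]
  refine Finset.sum_congr rfl fun i _ => ?_
  rw [adR_smul, Matrix.smul_mul, ← h i, Matrix.mul_smul, smul_comm]

theorem BrScale.basis {R : Type*} [CommRing R] [Algebra k R] {δ : R} {T : Matrix ι ι R}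
    (h : BrScale k g b δ T) (i : ι) :
    δ • (T * (adM k g b i).map (algebraMap k R)) = adR k g b (fun a => T a i) * T := by
  have := h (Pi.single i 1)
  rw [Matrix.mulVec_single_one] at this
  rw [← show adR k g b (Pi.single i (1 : R)) = (adM k g b i).map (algebraMap k R) from ?_]
  · exact this
  · rw [adR, Finset.sum_eq_single i]
    · simp
    · intro j _ hj
      simp [hj]
    · simp

theorem BrScale.map {R : Type*} [CommRing R] [Algebra k R] {R' : Type*} [CommRing R'] [Algebra k R']
    (φ : R →ₐ[k] R') {δ : R} {T : Matrix ι ι R}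
    (h : BrScale k g b δ T) : BrScale k g b (φ δ) (T.map φ) := by
  apply brScale_of_basis
  intro i
  have h1 := congrArg (fun M : Matrix ι ι R => M.map φ) (h.basis k g b i)
  simp only [Matrix.map_mul] at h1
  rw [← adR_map] at h1
  rw [show (fun a => T.map φ a i) = fun a => φ (T a i) from rfl, ← h1]
  ext a c
  simp [Matrix.mul_apply]

theorem brScale_poly (p : Matrix ι ι k[X]) (δ : k[X])
    (h : ∀ a : k, BrScale k g b (δ.eval a) (p.map (eval a))) : BrScale k g b δ p := by
  apply brScale_of_basis
  intro i
  ext1 c d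
  apply Polynomial.funext
  intro a
  have h1 := congrFun (congrFun ((h a).basis k g b i) c) d
  have h2 : adR k g b (fun c => p.map (eval a) c i) = (adR k g b (fun c => p c i)).map (aeval a) := by
    rw [← adR_map]
    congr 1
  rw [h2] at h1
  simpa [Matrix.mul_apply, eval_finsetSum, coe_aeval_eq_eval] using h1

theorem BrScale.mul {R : Type*} [CommRing R] [Algebra k R] {δ δ' : R} {T T' : Matrix ι ι R}
    (h : BrScale k g b δ T) (h' : BrScale k g b δ' T') : BrScale k g b (δ * δ') (T * T') := by
  intro u
  rw [← Matrix.mulVec_mulVec, ← mul_assoc, ← h, Matrix.smul_mul, mul_assoc, mul_assoc, ← h',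
    Matrix.mul_smul, smul_smul]

theorem det_smul_mid {R : Type*} [CommRing R] {s : ℕ} (w : R) (P : Matrix (Fin s) ι R)
    (C : Matrix ι ι R) (Q : Matrix ι (Fin s) R) :
    (P * (w • C) * Q).det = w ^ s * (P * C * Q).det := by
  rw [Matrix.mul_smul, Matrix.smul_mul, Matrix.det_smul]
  simp

theorem family_mod (p : Matrix ι ι k[X]) (δ : k[X]) (hp0 : p.map (eval 0) = 1)
    (hδ0 : δ.eval 0 = 1) (hb : BrScale k g b δ p) (N : ℕ)
    {s : ℕ} (hs : finrank k g < s + LieAlgebra.rank k g)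
    (P : Matrix (Fin s) ι k) (Q : Matrix ι (Fin s) k) :
    (X : k[X]) ^ N ∣ (P.map (algebraMap k k[X]) * (p - δ • 1) * Q.map (algebraMap k k[X])).det := by
  rw [← AdjoinRoot.mk_eq_zero]
  let π : k[X] →ₐ[k] AdjoinRoot ((X : k[X]) ^ N) := AdjoinRoot.mkₐ _
  have : Module.Finite k (AdjoinRoot ((X : k[X]) ^ N)) := (monic_X_pow N).finite_adjoinRoot
  change π _ = 0
  have hX : π X ^ N = 0 := by
    rw [← map_pow]; exact AdjoinRoot.mk_self
  have hdvd : ∀ a c, X ∣ (p - δ • (1 : Matrix ι ι k[X])) a c := by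
    intro a c
    rw [X_dvd_iff, coeff_zero_eq_eval_zero]
    have := congrFun (congrFun hp0 a) c
    rw [Matrix.map_apply] at this
    simp only [Matrix.sub_apply, Matrix.smul_apply, smul_eq_mul, eval_sub, eval_mul, this, hδ0]
    by_cases hac : a = c <;> simp [hac, Matrix.one_apply]
  choose B hB using hdvd
  have hδ1 : X ∣ δ - 1 := by
    rw [X_dvd_iff, coeff_zero_eq_eval_zero]; simp [hδ0]
  obtain ⟨q, hq⟩ := hδ1
  have hu : IsUnit (π δ) := by
    have h1 : π δ = 1 + π X * π q := by
      rw [← map_mul, ← hq]; simp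
    rw [h1]
    apply IsNilpotent.isUnit_one_add
    exact ⟨N, by rw [mul_pow, hX, zero_mul]⟩
  obtain ⟨w, hw⟩ := hu
  let C : Matrix ι ι (AdjoinRoot ((X : k[X]) ^ N)) := (p - δ • 1).map π
  have hC : C = p.map π - π δ • 1 := by
    ext a c
    simp only [C, Matrix.map_apply, Matrix.sub_apply, Matrix.smul_apply, smul_eq_mul, map_sub,
      map_mul]
    by_cases hac : a = c <;> simp [hac, Matrix.one_apply]
  have hCX : C = π X • (Matrix.of B).map π := by
    ext a c
    simp only [C, Matrix.map_apply, hB, Matrix.smul_apply, smul_eq_mul, map_mul, Matrix.of_apply]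
  let A := (↑w⁻¹ : AdjoinRoot ((X : k[X]) ^ N)) • C
  have hA1 : 1 + A = (↑w⁻¹ : AdjoinRoot ((X : k[X]) ^ N)) • p.map π := by
    simp only [A, hC, smul_sub, smul_smul, ← hw]
    simp
  have hAN : A ^ N = 0 := by
    simp only [A, hCX, _root_.smul_pow, hX, zero_smul, smul_zero]
  have hT : ∀ u v, (1 + A).mulVec ((adR k g b u).mulVec v) =
      (adR k g b ((1 + A).mulVec u)).mulVec ((1 + A).mulVec v) := by
    intro u v
    have h1 := (hb.map k g b π) u
    rw [← hw] at h1
    rw [Matrix.mulVec_mulVec, Matrix.mulVec_mulVec]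
    congr 1
    rw [hA1, Matrix.smul_mulVec, adR_smul, Matrix.smul_mul, Matrix.smul_mul, Matrix.mul_smul,
      ← h1, smul_smul, smul_smul]
    simp
  have key := minor_unipotent k g b A N hAN hT hs P Q
  rw [det_smul_mid, ← Units.val_pow_eq_pow_val, Units.mul_right_eq_zero] at key
  rw [AlgHom.map_det, ← key]
  rw [AlgHom.mapMatrix_apply, Matrix.map_mul, Matrix.map_mul]
  congr 1

theorem family_ker (p : Matrix ι ι k[X]) (δ : k[X]) (hp0 : p.map (eval 0) = 1)
    (hδ0 : δ.eval 0 = 1) (hb : ∀ a : k, BrScale k g b (δ.eval a) (p.map (eval a)))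
    (u : Module.End k g) (hu : LinearMap.toMatrix b b u = p.map (eval 1) - δ.eval 1 • 1) :
    LieAlgebra.rank k g ≤ finrank k (LinearMap.ker u) := by
  by_contra hlt
  push Not at hlt
  have hrk := finrank_ker_add_rank_toMatrix k g b u
  obtain ⟨s, hs⟩ : ∃ s, s = (LinearMap.toMatrix b b u).rank := ⟨_, rfl⟩
  have hlt2 : (LinearMap.toMatrix b b u).rank < s := by
    apply rank_lt_of_minor_eq_zero
    intro P Q
    have hz : (P.map (algebraMap k k[X]) * (p - δ • 1) * Q.map (algebraMap k k[X])).det = 0 := by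
      by_contra hne
      have h1 := family_mod k g b p δ hp0 hδ0 (brScale_poly k g b p δ hb)
        ((P.map (algebraMap k k[X]) * (p - δ • 1) * Q.map (algebraMap k k[X])).det.natDegree + 1)
        (by omega) P Q
      have h2 := natDegree_le_of_dvd h1 hne
      rw [natDegree_X_pow] at h2
      omega
    have h3 := congrArg (aeval (1 : k)) hz
    rw [AlgHom.map_det, map_zero] at h3
    rw [← h3, hu]
    congr 1
    rw [AlgHom.mapMatrix_apply, Matrix.map_mul, Matrix.map_mul]
    congr 1
    · congr 1
      · ext; simp
      · ext a c
        by_cases hac : a = c <;> simp [hac, coe_aeval_eq_eval, Matrix.one_apply]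
    · ext; simp
  omega

end

/-! ### Part F: inner automorphisms lie in polynomial families -/

theorem expEnd_props (n : g) (hn : IsNilpotent (ad k g n)) :
    (∀ x y, expEnd k g (ad k g n) ⁅x, y⁆ =
      ⁅expEnd k g (ad k g n) x, expEnd k g (ad k g n) y⁆) ∧
    expEnd k g (ad k g n) * expEnd k g (ad k g (-n)) = 1 := by
  let : Module ℚ g := Module.compHom g (algebraMap ℚ k)
  have hq : ∀ (q : ℚ) (x : g), q • x = (algebraMap ℚ k q) • x := fun q x => rfl
  have : SMulCommClass k ℚ g := ⟨fun a q x => by rw [hq, hq, smul_comm]⟩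
  have : IsScalarTower ℚ k g := ⟨fun q a x => by rw [hq, Algebra.smul_def, mul_smul]⟩
  let : LieAlgebra ℚ g := { lie_smul := fun q x y => by rw [hq, hq, lie_smul] }
  have hE : ∀ n : g, IsNilpotent (ad k g n) →
      expEnd k g (ad k g n) = IsNilpotent.exp (ad k g n) := by
    intro n hn
    have h0 : (ad k g n) ^ (finrank k g + 1) = 0 := by
      have h1 := LinearMap.aeval_self_charpoly (ad k g n)
      rw [IsNilpotent.charpoly_eq_X_pow_finrank hn] at h1
      rw [map_pow, Polynomial.aeval_X] at h1
      rw [pow_succ, h1, zero_mul]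
    rw [IsNilpotent.exp_eq_sum h0, expEnd]
    refine Finset.sum_congr rfl fun i _ => ?_
    ext x
    rw [LinearMap.smul_apply, LinearMap.smul_apply, hq]
    simp
  have hn' : IsNilpotent (ad k g (-n)) := by rw [map_neg]; exact hn.neg
  refine ⟨?_, ?_⟩
  · intro x y
    rw [hE n hn]
    have hc := LieDerivation.coe_ad_apply_eq_ad_apply (R := k) (L := g) n
    have hD : IsNilpotent (LieDerivation.ad k g n).toLinearMap := by
      change IsNilpotent (LieDerivation.ad k g n : g →ₗ[k] g)
      rw [hc]; exact hn
    have := (LieDerivation.exp (LieDerivation.ad k g n) hD).map_lie x y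
    simp only [LieDerivation.exp_map_apply] at this
    change IsNilpotent.exp (LieDerivation.ad k g n : g →ₗ[k] g) _ =
      ⁅IsNilpotent.exp (LieDerivation.ad k g n : g →ₗ[k] g) _,
        IsNilpotent.exp (LieDerivation.ad k g n : g →ₗ[k] g) _⁆ at this
    rw [hc] at this
    exact this
  · rw [hE n hn, hE _ hn', map_neg]
    exact hn.exp_mul_exp_neg_self

section
open Polynomial
variable {ι : Type*} [Fintype ι] [DecidableEq ι] (b : Basis ι k g)

theorem brScale_toMatrix (T : Module.End k g) (δ : k)
    (hT : ∀ x y, δ • T ⁅x, y⁆ = ⁅T x, T y⁆) :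
    BrScale k g b δ (LinearMap.toMatrix b b T) := by
  intro u
  obtain ⟨x, rfl⟩ : ∃ x : g, (b.repr x : ι → k) = u :=
    ⟨b.equivFun.symm u, b.equivFun.apply_symm_apply u⟩
  rw [LinearMap.toMatrix_mulVec_repr, adR_repr, adR_repr, ← LinearMap.toMatrix_mul,
    ← LinearMap.toMatrix_mul, ← map_smul]
  congr 1
  ext y
  simpa using hT x y

/-- A polynomial family of automorphisms connecting the identity to `T`. -/
def HasFamily (T : Module.End k g) : Prop :=
  ∃ p : Matrix ι ι k[X], p.map (eval 0) = 1 ∧ p.map (eval 1) = LinearMap.toMatrix b b T ∧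
    ∀ a, BrScale k g b 1 (p.map (eval a))

theorem hasFamily_exp (n : g) (hn : IsNilpotent (ad k g n)) :
    HasFamily k g b (expEnd k g (ad k g n)) := by
  let p : Matrix ι ι k[X] := Matrix.of fun a c => ∑ i ∈ Finset.range (finrank k g + 1),
    C ((i.factorial : k)⁻¹ * LinearMap.toMatrix b b ((ad k g n) ^ i) a c) * X ^ i
  have hp : ∀ a : k, p.map (eval a) = LinearMap.toMatrix b b (expEnd k g (ad k g (a • n))) := by
    intro a
    ext c d
    simp only [p, Matrix.map_apply, Matrix.of_apply, eval_finsetSum, eval_mul, eval_C, eval_pow,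
      eval_X, expEnd, map_sum, Matrix.sum_apply, map_smul, _root_.smul_pow, Matrix.smul_apply,
      smul_eq_mul]
    refine Finset.sum_congr rfl fun i _ => ?_
    ring
  refine ⟨p, ?_, ?_, ?_⟩
  · rw [hp, zero_smul, map_zero, expEnd, Finset.sum_range_succ']
    simp
  · rw [hp, one_smul]
  · intro a
    rw [hp]
    apply brScale_toMatrix
    intro x y
    rw [one_smul]
    refine (expEnd_props k g (a • n) ?_).1 x y
    rw [map_smul]
    exact hn.smul a

theorem HasFamily.mul {T T' : Module.End k g} (h : HasFamily k g b T) (h' : HasFamily k g b T') :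
    HasFamily k g b (T * T') := by
  obtain ⟨p, h0, h1, h2⟩ := h
  obtain ⟨p', h0', h1', h2'⟩ := h'
  have hm : ∀ a : k, (p * p').map (eval a) = p.map (eval a) * p'.map (eval a) := by
    intro a
    exact Matrix.map_mul (f := evalRingHom a)
  refine ⟨p * p', by rw [hm, h0, h0', mul_one], by rw [hm, h1, h1', LinearMap.toMatrix_mul], ?_⟩
  intro a
  rw [hm]
  have := (h2 a).mul k g b (h2' a)
  rwa [mul_one] at this

theorem hasFamily_inner (τ : g ≃ₗ[k] g) (hτ : τ ∈ IntG k g) :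
    HasFamily k g b (τ : g →ₗ[k] g) := by
  have key : HasFamily k g b (τ : g →ₗ[k] g) ∧
      HasFamily k g b ((τ⁻¹ : g ≃ₗ[k] g) : g →ₗ[k] g) := by
    unfold IntG at hτ
    induction hτ using Subgroup.closure_induction with
    | mem x hx =>
      obtain ⟨n, hn, hx⟩ := hx
      have hn' : IsNilpotent (ad k g (-n)) := by rw [map_neg]; exact hn.neg
      refine ⟨by rw [hx]; exact hasFamily_exp k g b n hn, ?_⟩
      have : ((x⁻¹ : g ≃ₗ[k] g) : g →ₗ[k] g) = expEnd k g (ad k g (-n)) := by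
        have h1 := (expEnd_props k g n hn).2
        rw [← hx] at h1
        ext y
        have h2 := LinearMap.congr_fun h1 y
        change x.symm y = _
        rw [LinearEquiv.symm_apply_eq]
        exact h2.symm
      rw [this]
      exact hasFamily_exp k g b (-n) hn'
    | one =>
      have h1 : HasFamily k g b (((1 : g ≃ₗ[k] g)) : g →ₗ[k] g) := by
        have := hasFamily_exp k g b 0 (by rw [map_zero]; exact IsNilpotent.zero)
        have he : expEnd k g (ad k g 0) = (((1 : g ≃ₗ[k] g)) : g →ₗ[k] g) := by
          rw [map_zero, expEnd, Finset.sum_range_succ']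
          simp
          rfl
        rwa [he] at this
      exact ⟨h1, by rw [inv_one]; exact h1⟩
    | mul x y _ _ hx hy =>
      refine ⟨hx.1.mul k g b hy.1, ?_⟩
      rw [mul_inv_rev]
      exact hy.2.mul k g b hx.2
    | inv x _ hx => exact ⟨hx.2, by rw [inv_inv]; exact hx.1⟩
  exact key.1

end

/-! ### Part G: gradings -/

section
variable {E : Type*} [AddCommGroup E] [Module k E] [FiniteDimensional k E]

/-- Data of a `ℤ`-grading with projections. -/
structure GrData (V : ℤ → Submodule k E) (M : ℕ) (π : ℤ → Module.End k E) : Prop where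
  mem : ∀ j x, π j x ∈ V j
  self : ∀ j, ∀ x ∈ V j, π j x = x
  ne : ∀ i j, i ≠ j → ∀ x ∈ V i, π j x = 0
  sum : ∀ x, ∑ j ∈ Finset.Icc (-(M : ℤ)) M, π j x = x
  bot : ∀ j, j ∉ Finset.Icc (-(M : ℤ)) M → V j = ⊥

theorem exists_grData (V : ℤ → Submodule k E) (hV : DirectSum.IsInternal V) :
    ∃ M π, GrData k V M π := by
  classical
  have hfin : {i | V i ≠ ⊥}.Finite :=
    WellFoundedGT.finite_ne_bot_of_iSupIndep hV.submodule_iSupIndep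
  obtain ⟨M, hM⟩ : ∃ M : ℕ, ∀ j, j ∉ Finset.Icc (-(M : ℤ)) M → V j = ⊥ := by
    refine ⟨∑ i ∈ hfin.toFinset, i.natAbs, fun j hj => ?_⟩
    by_contra hne
    have h1 : j ∈ hfin.toFinset := by simpa using hne
    have h2 := Finset.single_le_sum (f := fun i : ℤ => i.natAbs) (fun _ _ => Nat.zero_le _) h1
    apply hj
    rw [Finset.mem_Icc]
    omega
  let Φ := LinearEquiv.ofBijective (DirectSum.coeLinearMap V) hV
  let π : ℤ → Module.End k E := fun j =>
    (V j).subtype ∘ₗ DirectSum.component k ℤ (fun i => V i) j ∘ₗ Φ.symm.toLinearMap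
  have hΦ : ∀ i (x : V i), Φ.symm (x : E) = DirectSum.lof k ℤ (fun i => V i) i x := by
    intro i x
    rw [LinearEquiv.symm_apply_eq]
    exact (DirectSum.coeLinearMap_lof V i x).symm
  have hself : ∀ j, ∀ x ∈ V j, π j x = x := by
    intro j x hx
    have := hΦ j ⟨x, hx⟩
    simp only [π, LinearMap.comp_apply, LinearEquiv.coe_coe]
    simp only at this
    rw [this, DirectSum.component.lof_self]
    rfl
  have hne : ∀ i j, i ≠ j → ∀ x ∈ V i, π j x = 0 := by
    intro i j hij x hx
    have := hΦ i ⟨x, hx⟩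
    simp only [π, LinearMap.comp_apply, LinearEquiv.coe_coe]
    simp only at this
    rw [this, DirectSum.component.of, dif_neg hij]
    rfl
  refine ⟨M, π, ⟨fun j x => Submodule.coe_mem _, hself, hne, ?_, hM⟩⟩
  intro x
  have hx : x ∈ ⨆ i, V i := by rw [hV.submodule_iSup_eq_top]; trivial
  induction hx using Submodule.iSup_induction' with
  | mem i x hx =>
    by_cases hi : i ∈ Finset.Icc (-(M : ℤ)) M
    · rw [Finset.sum_eq_single_of_mem i hi (fun j _ hj => hne i j hj.symm x hx), hself i x hx]
    · rw [hM i hi, Submodule.mem_bot] at hx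
      simp [hx]
  | zero => simp
  | add x y _ _ hx hy => simp only [map_add, Finset.sum_add_distrib, hx, hy]

variable {V : ℤ → Submodule k E} {M : ℕ} {π : ℤ → Module.End k E}

theorem GrData.finrank_eq (hG : GrData k V M π) (U : Submodule k E)
    (hU : ∀ x ∈ U, ∀ j, π j x ∈ U) :
    finrank k U = ∑ j ∈ Finset.Icc (-(M : ℤ)) M, finrank k ↥(U ⊓ V j) := by
  let S := Finset.Icc (-(M : ℤ)) M
  let Ψ : U →ₗ[k] ((j : S) → ↥(U ⊓ V j)) := LinearMap.pi fun j =>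
    LinearMap.codRestrict (U ⊓ V j) ((π j).comp U.subtype)
      fun x => ⟨hU x x.2 j, hG.mem j x⟩
  have hΨ : ∀ (x : U) (j : S), ((Ψ x j : ↥(U ⊓ V j)) : E) = π j x := fun x j => rfl
  have hbij : Function.Bijective Ψ := by
    constructor
    · rw [← LinearMap.ker_eq_bot, LinearMap.ker_eq_bot']
      intro x hx
      ext
      rw [← hG.sum x]
      apply Finset.sum_eq_zero
      intro j hj
      rw [← hΨ x ⟨j, hj⟩, hx]
      rfl
    · intro y
      refine ⟨⟨∑ j, (y j : E), Submodule.sum_mem _ fun j _ => (y j).2.1⟩, ?_⟩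
      ext j
      rw [hΨ]
      simp only [map_sum]
      rw [Finset.sum_eq_single j]
      · exact hG.self _ _ (y j).2.2
      · intro i _ hij
        exact hG.ne i j (fun hh => hij (Subtype.ext hh)) _ (y i).2.2
      · simp
  rw [(LinearEquiv.ofBijective Ψ hbij).finrank_eq, Module.finrank_pi_fintype,
    ← Finset.sum_coe_sort S]

theorem GrData.proj_shift (hG : GrData k V M π) (T : Module.End k E) (s : ℤ)
    (hT : ∀ j, ∀ x ∈ V j, T x ∈ V (j + s)) (j : ℤ) (x : E) : π (j + s) (T x) = T (π j x) := by
  conv_lhs => rw [← hG.sum x]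
  simp only [map_sum]
  by_cases hj : j ∈ Finset.Icc (-(M : ℤ)) M
  · rw [Finset.sum_eq_single_of_mem j hj]
    · exact hG.self _ _ (hT _ _ (hG.mem _ _))
    · intro i _ hij
      exact hG.ne (i + s) (j + s) (by omega) _ (hT _ _ (hG.mem _ _))
  · have h0 : π j x = 0 := by
      have := hG.mem j x
      rwa [hG.bot j hj, Submodule.mem_bot] at this
    rw [h0, map_zero]
    apply Finset.sum_eq_zero
    intro i hi
    exact hG.ne (i + s) (j + s) (by intro hh; apply hj; rwa [← add_right_cancel hh]) _
      (hT _ _ (hG.mem _ _))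

theorem GrData.finrank_ker (hG : GrData k V M π) (T : Module.End k E) (s : ℤ)
    (hT : ∀ j, ∀ x ∈ V j, T x ∈ V (j + s)) :
    finrank k (LinearMap.ker T) =
      ∑ j ∈ Finset.Icc (-(M : ℤ)) M, finrank k ↥(LinearMap.ker T ⊓ V j) := by
  apply hG.finrank_eq
  intro x hx j
  rw [LinearMap.mem_ker] at hx ⊢
  rw [← hG.proj_shift k T s hT, hx, map_zero]

theorem GrData.finrank_top (hG : GrData k V M π) :
    finrank k E = ∑ j ∈ Finset.Icc (-(M : ℤ)) M, finrank k (V j) := by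
  have := hG.finrank_eq k ⊤ (fun _ _ _ => trivial)
  rw [_root_.finrank_top] at this
  rw [this]
  refine Finset.sum_congr rfl fun j _ => ?_
  rw [top_inf_eq]

end

/-! ### Part H: the weight decomposition -/

/-- Generalized weight spaces of `ad h` for integral weights. -/
noncomputable def wtV (h : g) (j : ℤ) : Submodule k g := (ad k g h).maxGenEigenspace (j : k)

theorem wtV_lie (h : g) {i j : ℤ} {x y : g} (hx : x ∈ wtV k g h i) (hy : y ∈ wtV k g h j) :
    ⁅x, y⁆ ∈ wtV k g h (i + j) := by
  unfold wtV
  rw [Int.cast_add]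
  exact LieModule.lie_mem_maxGenEigenspace_toEnd (R := k) (L := g) (M := g) hx hy

theorem mem_wtV_of_eig (h : g) {j : ℤ} {x : g} (hx : ⁅h, x⁆ = (j : k) • x) : x ∈ wtV k g h j := by
  have : x ∈ (ad k g h).eigenspace (j : k) := by
    rw [Module.End.mem_eigenspace_iff]; exact hx
  exact Module.End.eigenspace_le_maxGenEigenspace this

theorem prim_nat {e h f : g} (hhe : ⁅h, e⁆ = (2 : k) • e) (hhf : ⁅h, f⁆ = -((2 : k) • f))
    (hef : ⁅e, f⁆ = h) {v : g} (hv : v ≠ 0) {μ : k} (h1 : ⁅h, v⁆ = μ • v) (h2 : ⁅e, v⁆ = 0) :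
    ∃ n : ℕ, μ = n := by
  by_cases h0 : h = 0
  · refine ⟨0, ?_⟩
    rw [h0, zero_lie, eq_comm, smul_eq_zero] at h1
    simpa using h1.resolve_right hv
  · have t : IsSl2Triple h e f := ⟨h0, hef, by rw [hhe, two_smul, two_nsmul],
      by rw [hhf, two_smul, two_nsmul]⟩
    exact IsSl2Triple.HasPrimitiveVectorWith.exists_nat (t := t) (m := v) ⟨hv, h1, h2⟩

theorem eig_int {e h f : g} (hhe : ⁅h, e⁆ = (2 : k) • e) (hhf : ⁅h, f⁆ = -((2 : k) • f))
    (hef : ⁅e, f⁆ = h) (hen : IsNilpotent (ad k g e)) {v : g} (hv : v ≠ 0) {μ : k}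
    (h1 : ⁅h, v⁆ = μ • v) : ∃ j : ℤ, μ = j := by
  obtain ⟨N, hN⟩ := hen
  obtain ⟨n, hn1, hn2⟩ := Nat.exists_not_and_succ_of_not_zero_of_exists
    (p := fun n => ((ad k g e) ^ n) v = 0) (by simpa using hv) ⟨N, by rw [hN]; rfl⟩
  have hw : ∀ n : ℕ, ⁅h, ((ad k g e) ^ n) v⁆ = (μ + 2 * n) • ((ad k g e) ^ n) v := by
    intro n
    induction n with
    | zero => simpa using h1
    | succ n ih =>
      rw [pow_succ', Module.End.mul_apply, ad_apply, leibniz_lie, hhe, ih, lie_smul, smul_lie,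
        ← add_smul]
      congr 1
      push_cast; ring
  obtain ⟨r, hr⟩ := prim_nat k g hhe hhf hef hn1 (hw n) (by
    rw [pow_succ', Module.End.mul_apply] at hn2; exact hn2)
  refine ⟨(r : ℤ) - 2 * n, ?_⟩
  push_cast
  rw [← hr]; ring

theorem wtV_internal {e h f : g} (hhe : ⁅h, e⁆ = (2 : k) • e) (hhf : ⁅h, f⁆ = -((2 : k) • f))
    (hef : ⁅e, f⁆ = h) (hen : IsNilpotent (ad k g e)) : DirectSum.IsInternal (wtV k g h) := by
  rw [DirectSum.isInternal_submodule_iff_iSupIndep_and_iSup_eq_top]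
  constructor
  · exact (Module.End.independent_maxGenEigenspace (ad k g h)).comp
      (f := fun j : ℤ => (j : k)) Int.cast_injective
  · rw [eq_top_iff, ← Module.End.iSup_maxGenEigenspace_eq_top (ad k g h)]
    apply iSup_le
    intro μ
    by_cases hμ : (ad k g h).HasEigenvalue μ
    · obtain ⟨v, hv⟩ := hμ.exists_hasEigenvector
      obtain ⟨j, rfl⟩ := eig_int k g hhe hhf hef hen hv.2 hv.apply_eq_smul
      exact le_iSup (wtV k g h) j
    · have : (ad k g h).maxGenEigenspace μ = ⊥ := by
        by_contra hne
        exact hμ (Module.End.HasUnifEigenvalue.lt (k := ⊤) zero_lt_one hne)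
      rw [this]
      exact bot_le

theorem wtV_ade {e h : g} (hhe : ⁅h, e⁆ = (2 : k) • e) (j : ℤ) (x : g) (hx : x ∈ wtV k g h j) :
    ad k g e x ∈ wtV k g h (j + 2) := by
  rw [add_comm]
  exact wtV_lie k g h (mem_wtV_of_eig k g h (by simpa using hhe)) hx

theorem wtV_theta {h : g} (θ : g ≃ₗ[k] g) (hθb : ∀ x y : g, θ ⁅x, y⁆ = ⁅θ x, θ y⁆) (hθh : θ h = h)
    (j : ℤ) (x : g) (hx : x ∈ wtV k g h j) : θ x ∈ wtV k g h j := by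
  have hc : Commute (ad k g h) (θ : g →ₗ[k] g) := by
    ext y
    simp [Module.End.mul_apply, hθb, hθh]
  exact Module.End.mapsTo_maxGenEigenspace_of_comm hc (j : k) hx

section
variable {h : g} {M : ℕ} {π : ℤ → Module.End k g}

/-- The operator scaling `V_j` by `(1 + a) ^ (j + M)`. -/
noncomputable def torus (M : ℕ) (π : ℤ → Module.End k g) (a : k) : Module.End k g :=
  ∑ j ∈ Finset.Icc (-(M : ℤ)) M, (1 + a) ^ (j + M).toNat • π j

theorem torus_apply (hG : GrData k (wtV k g h) M π) (a : k) {j : ℤ} {x : g}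
    (hx : x ∈ wtV k g h j) : torus k g M π a x = (1 + a) ^ (j + M).toNat • x := by
  by_cases hj : j ∈ Finset.Icc (-(M : ℤ)) M
  · rw [torus, LinearMap.sum_apply, Finset.sum_eq_single_of_mem j hj, LinearMap.smul_apply,
      hG.self j x hx]
    intro i _ hij
    rw [LinearMap.smul_apply, hG.ne j i hij.symm x hx, smul_zero]
  · rw [hG.bot j hj, Submodule.mem_bot] at hx
    simp [hx]

theorem torus_lie (hG : GrData k (wtV k g h) M π) (a : k) (x y : g) :
    (1 + a) ^ M • torus k g M π a ⁅x, y⁆ = ⁅torus k g M π a x, torus k g M π a y⁆ := by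
  have key : ∀ i ∈ Finset.Icc (-(M : ℤ)) M, ∀ j ∈ Finset.Icc (-(M : ℤ)) M,
      ∀ x ∈ wtV k g h i, ∀ y ∈ wtV k g h j,
      (1 + a) ^ M • torus k g M π a ⁅x, y⁆ = ⁅torus k g M π a x, torus k g M π a y⁆ := by
    intro i hi j hj x hx y hy
    have hxy := wtV_lie k g h hx hy
    rw [torus_apply k g hG a hx, torus_apply k g hG a hy, torus_apply k g hG a hxy,
      smul_lie, lie_smul, smul_smul, smul_smul]
    by_cases hij : i + j ∈ Finset.Icc (-(M : ℤ)) M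
    · rw [← pow_add, ← pow_add]
      congr 2
      rw [Finset.mem_Icc] at hi hj hij
      omega
    · rw [hG.bot _ hij, Submodule.mem_bot] at hxy
      rw [hxy, smul_zero, smul_zero]
  rw [← hG.sum x, ← hG.sum y]
  simp only [sum_lie, lie_sum, map_sum, Finset.smul_sum]
  refine Finset.sum_congr rfl fun i hi => Finset.sum_congr rfl fun j hj => ?_
  exact key _ hj _ hi _ (hG.mem _ _) _ (hG.mem _ _)

open Polynomial in
theorem torus_ker (hG : GrData k (wtV k g h) M π) (θ : g ≃ₗ[k] g) (hθ : θ ∈ IntG k g) :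
    LieAlgebra.rank k g ≤ finrank k (LinearMap.ker
      ((θ : g →ₗ[k] g) * torus k g M π 1 - (2 : k) ^ M • (1 : Module.End k g))) := by
  let b := Module.finBasis k g
  obtain ⟨p, h0, h1, h2⟩ := hasFamily_inner k g b θ hθ
  let q : Matrix (Fin (finrank k g)) (Fin (finrank k g)) k[X] :=
    Matrix.of fun a c => ∑ j ∈ Finset.Icc (-(M : ℤ)) M,
      (1 + X) ^ (j + M).toNat * C (LinearMap.toMatrix b b (π j) a c)
  have hq : ∀ a : k, q.map (eval a) = LinearMap.toMatrix b b (torus k g M π a) := by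
    intro a
    ext c d
    simp [q, torus, eval_finsetSum, Matrix.sum_apply]
  have hm : ∀ a : k, (p * q).map (eval a) = p.map (eval a) * q.map (eval a) := by
    intro a
    exact Matrix.map_mul (f := evalRingHom a)
  apply family_ker k g b (p * q) ((1 + X) ^ M)
  · rw [hm, h0, hq, one_mul]
    have : torus k g M π 0 = LinearMap.id := by
      ext x
      rw [torus, LinearMap.sum_apply]
      simpa using hG.sum x
    rw [this, LinearMap.toMatrix_id]
  · simp
  · intro a
    rw [hm, hq]
    have h3 : BrScale k g b ((1 + a) ^ M) (LinearMap.toMatrix b b (torus k g M π a)) :=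
      brScale_toMatrix k g b _ _ (torus_lie k g hG a)
    have := (h2 a).mul k g b h3
    simpa using this
  · rw [hm, hq, h1, map_sub, LinearMap.toMatrix_mul, map_smul, LinearMap.toMatrix_one]
    simp only [eval_pow, eval_add, eval_one, eval_X, one_add_one_eq_two]

theorem rank_le_fixed (hG : GrData k (wtV k g h) M π) (m : ℕ) (hm : 1 ≤ m)
    (θ : g ≃ₗ[k] g) (hθb : ∀ x y : g, θ ⁅x, y⁆ = ⁅θ x, θ y⁆) (hθm : θ ^ m = 1)
    (hθh : θ h = h) (hθ : θ ∈ IntG k g) :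
    LieAlgebra.rank k g ≤
      finrank k ↥(LinearMap.ker ((θ : g →ₗ[k] g) - 1) ⊓ wtV k g h 0) := by
  refine (torus_ker k g hG θ hθ).trans (Submodule.finrank_mono ?_)
  set u : Module.End k g := (θ : g →ₗ[k] g) * torus k g M π 1 - (2 : k) ^ M • (1 : Module.End k g)
    with hu
  have hθV := wtV_theta k g θ hθb hθh
  have huV : ∀ j, ∀ x ∈ wtV k g h j, u x = (2 : k) ^ (j + M).toNat • θ x - (2 : k) ^ M • x := by
    intro j x hx
    simp only [hu, LinearMap.sub_apply, Module.End.mul_apply, torus_apply k g hG 1 hx, map_smul,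
      LinearMap.smul_apply, Module.End.one_apply, one_add_one_eq_two]
    rfl
  have huM : ∀ j, ∀ x ∈ wtV k g h j, u x ∈ wtV k g h (j + 0) := by
    intro j x hx
    rw [huV j x hx, add_zero]
    exact Submodule.sub_mem _ (Submodule.smul_mem _ _ (hθV j x hx)) (Submodule.smul_mem _ _ hx)
  intro x hx
  rw [LinearMap.mem_ker] at hx
  have hcomp : ∀ j ∈ Finset.Icc (-(M : ℤ)) M, j ≠ 0 → π j x = 0 := by
    intro j hj hj0
    by_contra hne
    have h1 := hG.proj_shift k u 0 huM j x
    rw [hx, map_zero, huV j _ (hG.mem j x), eq_comm, sub_eq_zero] at h1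
    have h2 : ∀ n : ℕ, ((2 : k) ^ (j + M).toNat) ^ n • (θ ^ n) (π j x) =
        ((2 : k) ^ M) ^ n • π j x := by
      intro n
      induction n with
      | zero => simp
      | succ n ih =>
        have h3 := congrArg θ ih
        rw [map_smul, map_smul] at h3
        rw [pow_succ' θ, LinearEquiv.mul_apply, pow_succ', mul_smul, h3, smul_comm, h1, smul_smul,
          ← pow_succ]
    have h3 := h2 m
    rw [hθm, ← sub_eq_zero] at h3
    change _ • (π j x) - _ = _ at h3
    rw [← sub_smul, smul_eq_zero, or_iff_left hne, sub_eq_zero, ← pow_mul, ← pow_mul] at h3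
    have h4 : (2 : ℕ) ^ ((j + M).toNat * m) = 2 ^ (M * m) := by exact_mod_cast h3
    have h5 := Nat.pow_right_injective le_rfl h4
    have h6 : (j + M).toNat = M := Nat.eq_of_mul_eq_mul_right (by omega) h5
    rw [Finset.mem_Icc] at hj
    omega
  have hx0 : π 0 x = x := by
    conv_rhs => rw [← hG.sum x]
    rw [Finset.sum_eq_single_of_mem 0 (by simp) hcomp]
  have hx1 : x ∈ wtV k g h 0 := by rw [← hx0]; exact hG.mem 0 x
  refine ⟨?_, hx1⟩
  rw [huV 0 x hx1, zero_add, Int.toNat_natCast, ← smul_sub, smul_eq_zero] at hx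
  change x ∈ LinearMap.ker _
  rw [LinearMap.mem_ker]
  exact hx.resolve_left (pow_ne_zero _ two_ne_zero)

end

/-! ### Part I: arithmetic lemmas -/

theorem sum_Icc_int (F : ℤ → ℤ) (M : ℕ) :
    ∑ c ∈ Finset.Icc (-(M : ℤ)) M, F c =
      F 0 + ∑ n ∈ Finset.range M, (F (n + 1) + F (-(n + 1))) := by
  induction M with
  | zero => simp
  | succ M ih =>
    have : Finset.Icc (-((M + 1 : ℕ) : ℤ)) ((M + 1 : ℕ) : ℤ) =
        insert ((M : ℤ) + 1) (insert (-((M : ℤ) + 1)) (Finset.Icc (-(M : ℤ)) M)) := by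
      ext x
      simp only [Finset.mem_Icc, Finset.mem_insert]
      push_cast
      omega
    rw [this, Finset.sum_insert, Finset.sum_insert, ih, Finset.sum_range_succ]
    · ring
    · simp only [Finset.mem_Icc]; omega
    · simp only [Finset.mem_Icc, Finset.mem_insert]; omega

theorem telescope_two (a : ℤ → ℤ) (N : ℕ) :
    ∑ n ∈ Finset.range N, (a n - a (n + 2)) = a 0 + a 1 - a N - a (N + 1) := by
  induction N with
  | zero => simp
  | succ N ih =>
    rw [Finset.sum_range_succ, ih]
    push_cast
    rw [show (N : ℤ) + 1 + 1 = N + 2 by ring]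
    ring

theorem count_equality (M : ℕ) (a z : ℤ → ℕ) (r : ℕ) (h1 : ∀ j, a j ≤ z j + a (j + 2))
    (hM : ∀ j : ℤ, (M : ℤ) < j → a j = 0)
    (hr : ∑ j ∈ Finset.Icc (-(M : ℤ)) M, z j = r) (hr2 : r ≤ a 0) :
    a 0 = r ∧ a 1 = 0 ∧ (∀ j : ℤ, -(M : ℤ) ≤ j → j < 0 → z j = 0) ∧
      ∀ j : ℤ, 0 ≤ j → j ≤ M → a j = z j + a (j + 2) := by
  have hr' : ∑ j ∈ Finset.Icc (-(M : ℤ)) M, (z j : ℤ) = r := by exact_mod_cast hr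
  rw [sum_Icc_int] at hr'
  have ht := telescope_two (fun j => (a j : ℤ)) (M + 1)
  rw [Finset.sum_range_succ'] at ht
  have e1 := hM ((M + 1 : ℕ) : ℤ) (by push_cast; omega)
  have e2 := hM ((M + 1 : ℕ) + 1 : ℤ) (by push_cast; omega)
  simp only [e1, e2] at ht
  have hs : ((z 0 : ℤ) + a (0 + 2) - a 0) + ∑ n ∈ Finset.range M,
      (((z ((n : ℤ) + 1) : ℤ) + a ((n : ℤ) + 1 + 2) - a ((n : ℤ) + 1)) + z (-((n : ℤ) + 1))) + a 1
        + (a 0 - r) = 0 := by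
    have : ∑ n ∈ Finset.range M,
      (((z ((n : ℤ) + 1) : ℤ) + a ((n : ℤ) + 1 + 2) - a ((n : ℤ) + 1)) + z (-((n : ℤ) + 1)))
      = ∑ n ∈ Finset.range M, ((z ((n : ℤ) + 1) : ℤ) + z (-((n : ℤ) + 1)))
        - ∑ n ∈ Finset.range M, ((a ((n + 1 : ℕ) : ℤ) : ℤ) - a (((n + 1 : ℕ) : ℤ) + 2)) := by
      rw [← Finset.sum_sub_distrib]
      refine Finset.sum_congr rfl fun n _ => ?_
      push_cast
      ring
    rw [this]
    simp only [Nat.cast_zero] at ht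
    linarith
  have hpos : ∀ n ∈ Finset.range M,
      0 ≤ (((z ((n : ℤ) + 1) : ℤ) + a ((n : ℤ) + 1 + 2) - a ((n : ℤ) + 1)) + z (-((n : ℤ) + 1))) := by
    intro n _
    have := h1 ((n : ℤ) + 1)
    omega
  have hpos' := Finset.sum_nonneg hpos
  have h10 := h1 0
  have hz : ∑ n ∈ Finset.range M,
      (((z ((n : ℤ) + 1) : ℤ) + a ((n : ℤ) + 1 + 2) - a ((n : ℤ) + 1)) + z (-((n : ℤ) + 1))) = 0 := by
    omega
  have hz' := (Finset.sum_eq_zero_iff_of_nonneg hpos).1 hz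
  refine ⟨by omega, by omega, ?_, ?_⟩
  · intro j hj hj0
    obtain ⟨n, rfl⟩ : ∃ n : ℕ, j = -((n : ℤ) + 1) := ⟨(-j - 1).toNat, by omega⟩
    have h2 := hz' n (by rw [Finset.mem_range]; omega)
    have := h1 ((n : ℤ) + 1)
    omega
  · intro j hj hj0
    by_cases hj1 : j = 0
    · subst hj1; omega
    obtain ⟨n, rfl⟩ : ∃ n : ℕ, j = ((n : ℤ) + 1) := ⟨(j - 1).toNat, by omega⟩
    have h2 := hz' n (by rw [Finset.mem_range]; omega)
    have := h1 ((n : ℤ) + 1)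
    omega

theorem phi_step (m : ℕ) (hm : 1 ≤ m) (n : ℕ) :
    ((m : ℤ) - 1 - 2 * (((n : ℤ) + 1) % m)) - ((m : ℤ) - 1 - 2 * ((n : ℤ) % m)) =
      -2 + if (m : ℤ) ∣ (n : ℤ) + 1 then 2 * (m : ℤ) else 0 := by
  have hm0 : (0 : ℤ) < m := by exact_mod_cast hm
  have hlt := Int.emod_lt_of_pos (n : ℤ) hm0
  have hnn := Int.emod_nonneg (n : ℤ) hm0.ne'
  have hn := Int.mul_ediv_add_emod (n : ℤ) m
  by_cases h : (n : ℤ) % m + 1 = m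
  · have h1 : (m : ℤ) ∣ (n : ℤ) + 1 := ⟨(n : ℤ) / m + 1, by rw [mul_add, mul_one]; linarith⟩
    rw [if_pos h1, Int.emod_eq_zero_of_dvd h1]
    linarith
  · have h2 : ((n : ℤ) + 1) % m = (n : ℤ) % m + 1 := by
      rw [Int.add_emod]
      by_cases hm1 : m = 1
      · subst hm1; exfalso; apply h; omega
      · rw [Int.emod_eq_of_lt (a := 1) (by omega) (by omega)]
        exact Int.emod_eq_of_lt (by omega) (by omega)
    have h1 : ¬ (m : ℤ) ∣ (n : ℤ) + 1 := by
      intro hd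
      rw [Int.dvd_iff_emod_eq_zero, h2] at hd
      omega
    rw [if_neg h1, h2]
    ring

theorem abel_sum (φ A : ℤ → ℤ) (N : ℕ) :
    φ 0 * (A 0 - A 1) + ∑ n ∈ Finset.range N, φ (n + 1) * (A (n + 1) - A (n + 2)) =
      φ 0 * A 0 + ∑ n ∈ Finset.range N, (φ (n + 1) - φ n) * A (n + 1) - φ N * A (N + 1) := by
  induction N with
  | zero => simp; ring
  | succ N ih =>
    rw [Finset.sum_range_succ, Finset.sum_range_succ, ← add_assoc, ih]
    push_cast
    rw [show (N : ℤ) + 1 + 1 = N + 2 by ring]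
    ring

theorem final_count (m : ℕ) (hm : 1 ≤ m) (M : ℕ) (A Z : ℤ → ℤ) (hM : A (M + 1) = 0)
    (hsym : ∀ c, A (-c) = A c) (hZneg : ∀ c, c < 0 → Z c = 0)
    (hZ : ∀ c, 0 ≤ c → A c = Z c + A (c + 1)) :
    (m : ℤ) * ∑ c ∈ Finset.Icc (-(M : ℤ)) M, (if (m : ℤ) ∣ c then A c else 0) =
      ∑ c ∈ Finset.Icc (-(M : ℤ)) M, A c +
      ∑ c ∈ Finset.Icc (-(M : ℤ)) M, ((m : ℤ) - 1 - 2 * (c % m)) * Z c := by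
  rw [sum_Icc_int, sum_Icc_int, sum_Icc_int]
  have habel := abel_sum (fun c => (m : ℤ) - 1 - 2 * (c % m)) A M
  have h3 : ∑ n ∈ Finset.range M, (((m : ℤ) - 1 - 2 * (((n : ℤ) + 1) % m)) * Z (n + 1) +
      ((m : ℤ) - 1 - 2 * ((-((n : ℤ) + 1)) % m)) * Z (-(n + 1))) =
      ∑ n ∈ Finset.range M, ((m : ℤ) - 1 - 2 * (((n : ℤ) + 1) % m)) * (A (n + 1) - A (n + 2)) := by
    refine Finset.sum_congr rfl fun n _ => ?_
    rw [hZneg (-((n : ℤ) + 1)) (by omega), hZ (n + 1) (by omega),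
      show (n : ℤ) + 1 + 1 = n + 2 by ring]
    ring
  rw [h3]
  have h0 : Z 0 = A 0 - A 1 := by
    have := hZ 0 le_rfl
    simp only [zero_add] at this
    linarith
  rw [h0]
  simp only [phi_step m hm, hM] at habel
  rw [habel]
  simp only [hsym, dvd_neg, Int.zero_emod, dvd_zero, if_true]
  rw [mul_add, Finset.mul_sum]
  have h4 : ∑ n ∈ Finset.range M, (m : ℤ) * ((if (m : ℤ) ∣ (n : ℤ) + 1 then A (n + 1) else 0) +
      if (m : ℤ) ∣ (n : ℤ) + 1 then A (n + 1) else 0) =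
      ∑ n ∈ Finset.range M, (A (n + 1) + A (n + 1)) + ∑ n ∈ Finset.range M,
        (-2 + if (m : ℤ) ∣ (n : ℤ) + 1 then 2 * (m : ℤ) else 0) * A (n + 1) := by
    rw [← Finset.sum_add_distrib]
    refine Finset.sum_congr rfl fun n _ => ?_
    split_ifs <;> ring
  rw [h4]
  ring

theorem phi_sum (m : ℕ) (hm : 1 ≤ m) (c : ℤ) :
    ∑ i ∈ Finset.range m, (if (c : ZMod m) = ((i : ℕ) : ZMod m) then ((m : ℤ) - 1 - 2 * (i : ℤ)) else 0) =
      (m : ℤ) - 1 - 2 * (c % m) := by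
  have hm0 : (0 : ℤ) < m := by exact_mod_cast hm
  have hlt := Int.emod_lt_of_pos c hm0
  have hnn := Int.emod_nonneg c hm0.ne'
  have key : ∀ i ∈ Finset.range m, ((c : ZMod m) = ((i : ℕ) : ZMod m) ↔ i = (c % m).toNat) := by
    intro i hi
    rw [Finset.mem_range] at hi
    rw [show ((i : ℕ) : ZMod m) = ((i : ℤ) : ZMod m) by simp, ZMod.intCast_eq_intCast_iff', 
      Int.emod_eq_of_lt (a := (i : ℤ)) (by omega) (by omega)]
    omega
  rw [Finset.sum_eq_single_of_mem (c % m).toNat (by rw [Finset.mem_range]; omega)]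
  · rw [if_pos ((key _ (by rw [Finset.mem_range]; omega)).2 rfl), Int.toNat_of_nonneg hnn]
  · intro i hi hne
    rw [if_neg]
    rw [key i hi]
    exact hne

/-! ### Part J: structure of the grading and the dimension formula -/

section
variable {e h f : g} {M : ℕ} {π : ℤ → Module.End k g}

theorem rank_nullity_on (T : Module.End k g) (V : Submodule k g) :
    finrank k V = finrank k ↥(LinearMap.ker T ⊓ V) + finrank k ↥(V.map T) := by
  have h1 := LinearMap.finrank_range_add_finrank_ker (T.domRestrict V)
  have h2 : finrank k ↥(LinearMap.ker (T.domRestrict V)) = finrank k ↥(LinearMap.ker T ⊓ V) := by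
    rw [LinearMap.ker_domRestrict]
    have := (Submodule.equivMapOfInjective V.subtype V.injective_subtype
      ((LinearMap.ker T).comap V.subtype)).finrank_eq
    rw [Submodule.map_comap_subtype, inf_comm] at this
    exact this
  rw [LinearMap.range_domRestrict, h2] at h1
  omega

theorem wtV_symm (hV : DirectSum.IsInternal (wtV k g h)) (hG : GrData k (wtV k g h) M π) (j : ℤ) :
    finrank k (wtV k g h j) ≤ finrank k (wtV k g h (-j)) := by
  have horth : ∀ i j : ℤ, i + j ≠ 0 → ∀ x ∈ wtV k g h i, ∀ y ∈ wtV k g h j,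
      killingForm k g x y = 0 := by
    intro i j hij x hx y hy
    rw [killingForm_apply_apply]
    refine LinearMap.trace_eq_zero_of_mapsTo_ne hV (fun n => i + (j + n)) (fun n => by omega) ?_
    intro n z hz
    exact wtV_lie k g h hx (wtV_lie k g h hy hz)
  rw [← Subspace.dual_finrank_eq (V := wtV k g h (-j))]
  let Ψ : wtV k g h j →ₗ[k] Module.Dual k (wtV k g h (-j)) :=
    (LinearMap.lcomp k k (wtV k g h (-j)).subtype) ∘ₗ (killingForm k g) ∘ₗ (wtV k g h j).subtype
  refine LinearMap.finrank_le_finrank_of_injective (f := Ψ) ?_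
  rw [← LinearMap.ker_eq_bot, LinearMap.ker_eq_bot']
  intro x hx
  have h1 : ∀ y ∈ wtV k g h (-j), killingForm k g x y = 0 := fun y hy =>
    LinearMap.congr_fun hx ⟨y, hy⟩
  have h2 : killingForm k g (x : g) = 0 := by
    ext y
    rw [← hG.sum y, map_sum, LinearMap.zero_apply]
    apply Finset.sum_eq_zero
    intro i _
    by_cases hi : i = -j
    · subst hi; exact h1 _ (hG.mem _ _)
    · exact horth j i (by omega) _ x.2 _ (hG.mem _ _)
  have h3 : (x : g) ∈ LinearMap.ker (killingForm k g) := h2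
  rw [LieAlgebra.IsKilling.ker_killingForm_eq_bot, Submodule.mem_bot] at h3
  exact Subtype.ext h3

theorem wtV_struct (hhe : ⁅h, e⁆ = (2 : k) • e) (hG : GrData k (wtV k g h) M π)
    (her : finrank k (zc k g e) = LieAlgebra.rank k g)
    (hr : LieAlgebra.rank k g ≤ finrank k (wtV k g h 0)) :
    finrank k (wtV k g h 0) = LieAlgebra.rank k g ∧ wtV k g h 1 = ⊥ ∧
    (∀ j : ℤ, j < 0 → LinearMap.ker (ad k g e) ⊓ wtV k g h j = ⊥) ∧
    (∀ j : ℤ, 0 ≤ j → (wtV k g h j).map (ad k g e) = wtV k g h (j + 2)) := by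
  have hmap : ∀ j, (wtV k g h j).map (ad k g e) ≤ wtV k g h (j + 2) := by
    intro j
    rw [Submodule.map_le_iff_le_comap]
    exact fun x hx => wtV_ade k g hhe j x hx
  have hrn := fun j => rank_nullity_on k g (ad k g e) (wtV k g h j)
  obtain ⟨c1, c2, c3, c4⟩ := count_equality M (fun j => finrank k (wtV k g h j))
    (fun j => finrank k ↥(LinearMap.ker (ad k g e) ⊓ wtV k g h j)) (LieAlgebra.rank k g)
    (fun j => by
      have := hrn j
      have := Submodule.finrank_mono (hmap j)
      omega)
    (fun j hj => by
      rw [hG.bot j (by rw [Finset.mem_Icc]; omega), finrank_bot])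
    (by rw [← hG.finrank_ker k _ 2 (wtV_ade k g hhe)]; exact her) hr
  refine ⟨c1, Submodule.finrank_eq_zero.1 c2, ?_, ?_⟩
  · intro j hj
    by_cases hjM : -(M : ℤ) ≤ j
    · exact Submodule.finrank_eq_zero.1 (c3 j hjM hj)
    · rw [hG.bot j (by rw [Finset.mem_Icc]; omega), inf_bot_eq]
  · intro j hj
    by_cases hjM : j ≤ M
    · apply Submodule.eq_of_le_of_finrank_eq (hmap j)
      have := hrn j
      have := c4 j hj hjM
      omega
    · rw [hG.bot j (by rw [Finset.mem_Icc]; omega), hG.bot (j + 2) (by rw [Finset.mem_Icc]; omega),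
        Submodule.map_bot]

theorem wtV_odd (hhe : ⁅h, e⁆ = (2 : k) • e) (h1 : wtV k g h 1 = ⊥)
    (h2 : ∀ j : ℤ, j < 0 → LinearMap.ker (ad k g e) ⊓ wtV k g h j = ⊥)
    (h3 : ∀ j : ℤ, 0 ≤ j → (wtV k g h j).map (ad k g e) = wtV k g h (j + 2)) (c : ℤ) :
    wtV k g h (2 * c + 1) = ⊥ := by
  induction c using Int.induction_on with
  | zero => simpa using h1
  | succ n ih =>
    rw [show 2 * ((n : ℤ) + 1) + 1 = (2 * n + 1) + 2 by ring, ← h3 _ (by omega), ih,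
      Submodule.map_bot]
  | pred n ih =>
    rw [eq_bot_iff]
    intro x hx
    rw [← h2 (2 * (-(n : ℤ) - 1) + 1) (by omega)]
    refine ⟨?_, hx⟩
    have := wtV_ade k g hhe _ x hx
    rw [show 2 * (-(n : ℤ) - 1) + 1 + 2 = 2 * (-n) + 1 by ring, ih, Submodule.mem_bot] at this
    exact this

theorem wtV_zeta (hhe : ⁅h, e⁆ = (2 : k) • e) {ζ : k} (hζ : ζ ≠ 0) (θ : g ≃ₗ[k] g)
    (hθb : ∀ x y : g, θ ⁅x, y⁆ = ⁅θ x, θ y⁆) (hθh : θ h = h) (hθe : θ e = ζ • e)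
    (h0 : ∀ x ∈ wtV k g h 0, θ x = x)
    (h2 : ∀ j : ℤ, j < 0 → LinearMap.ker (ad k g e) ⊓ wtV k g h j = ⊥)
    (h3 : ∀ j : ℤ, 0 ≤ j → (wtV k g h j).map (ad k g e) = wtV k g h (j + 2)) (c : ℤ) :
    ∀ x ∈ wtV k g h (2 * c), θ x = ζ ^ c • x := by
  induction c using Int.induction_on with
  | zero => simpa using h0
  | succ n ih =>
    intro x hx
    rw [show 2 * ((n : ℤ) + 1) = (2 * n) + 2 by ring, ← h3 _ (by omega)] at hx
    obtain ⟨y, hy, rfl⟩ := hx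
    rw [ad_apply, hθb, hθe, ih y hy, smul_lie, lie_smul, smul_smul, zpow_add_one₀ hζ, mul_comm]
  | pred n ih =>
    intro x hx
    have h4 := wtV_ade k g hhe _ x hx
    rw [show 2 * (-(n : ℤ) - 1) + 2 = 2 * (-n) by ring] at h4
    have h5 := ih _ h4
    rw [ad_apply, hθb, hθe, smul_lie] at h5
    have h6 : θ x - ζ ^ (-(n : ℤ) - 1) • x ∈
        LinearMap.ker (ad k g e) ⊓ wtV k g h (2 * (-(n : ℤ) - 1)) := by
      refine ⟨?_, Submodule.sub_mem _ (wtV_theta k g θ hθb hθh _ x hx) (Submodule.smul_mem _ _ hx)⟩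
      change ⁅e, _⁆ = 0
      have h7 : ζ • ⁅e, θ x - ζ ^ (-(n : ℤ) - 1) • x⁆ = 0 := by
        rw [lie_sub, smul_sub, h5, lie_smul, smul_smul, zpow_sub_one₀ hζ, mul_comm ζ,
          inv_mul_cancel_right₀ hζ, sub_self]
      exact (smul_eq_zero.1 h7).resolve_left hζ
    rw [h2 _ (by omega), Submodule.mem_bot, sub_eq_zero] at h6
    exact h6

theorem GrData.even (hG : GrData k (wtV k g h) M π)
    (hodd : ∀ c : ℤ, wtV k g h (2 * c + 1) = ⊥) :
    GrData k (fun c => wtV k g h (2 * c)) M (fun c => π (2 * c)) where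
  mem j x := hG.mem _ x
  self j x hx := hG.self _ x hx
  ne i j hij x hx := hG.ne _ _ (by omega) x hx
  bot j hj := hG.bot _ (by rw [Finset.mem_Icc] at hj ⊢; omega)
  sum x := by
    classical
    conv_rhs => rw [← hG.sum x]
    rw [← Finset.sum_image (s := Finset.Icc (-(M : ℤ)) M) (g := fun c : ℤ => 2 * c)
      (f := fun j => π j x) (fun a _ b _ hab => by simpa using hab)]
    have hz : ∀ j, wtV k g h j = ⊥ → π j x = 0 := by
      intro j hj
      have := hG.mem j x
      rwa [hj, Submodule.mem_bot] at this
    symm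
    rw [← Finset.sum_filter_of_ne (p := fun j => ∃ c, j = 2 * c)]
    · apply Finset.sum_subset
      · intro j hj
        rw [Finset.mem_filter, Finset.mem_Icc] at hj
        obtain ⟨hj, c, rfl⟩ := hj
        rw [Finset.mem_image]
        exact ⟨c, by rw [Finset.mem_Icc]; omega, rfl⟩
      · intro j hj hj2
        apply hz
        apply hG.bot
        intro hj3
        apply hj2
        rw [Finset.mem_image] at hj
        obtain ⟨c, -, rfl⟩ := hj
        exact Finset.mem_filter.2 ⟨hj3, c, rfl⟩
    · intro j _ hj
      by_contra hne
      apply hj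
      apply hz
      have : j = 2 * (j / 2) + 1 := by
        have : j % 2 ≠ 0 := fun h0 => hne ⟨j / 2, by omega⟩
        omega
      rw [this]
      exact hodd _

theorem wtV_eq_eigenspace (hr : finrank k (wtV k g h 0) = LieAlgebra.rank k g) (j : ℤ) :
    wtV k g h j = (ad k g h).eigenspace (j : k) := by
  have h1 : finrank k (LieSubalgebra.engel k h) = LieAlgebra.rank k g := by
    rw [← hr]
    unfold wtV
    rw [Int.cast_zero]
    rfl
  have := isCartan_engel_of_regular k g h ((LieAlgebra.isRegular_iff_finrank_engel_eq_rank k h).2 h1)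
  have h2 := LieAlgebra.IsKilling.isSemisimple_ad_of_mem_isCartanSubalgebra
    (K := k) (H := LieSubalgebra.engel k h) (LieSubalgebra.self_mem_engel k h)
  exact h2.isFinitelySemisimple.maxGenEigenspace_eq_eigenspace _

end

theorem dim_g0_formula
    (m : ℕ) (hm : 1 ≤ m) (ζ : k) (hζ : IsPrimitiveRoot ζ m)
    (θ : g ≃ₗ[k] g) (hθb : ∀ x y : g, θ ⁅x, y⁆ = ⁅θ x, θ y⁆) (hθm : θ ^ m = 1)
    (hθinner : θ ∈ IntG k g)
    (e h f : g)
    (hhe : ⁅h, e⁆ = (2 : k) • e) (hhf : ⁅h, f⁆ = -((2 : k) • f)) (hef : ⁅e, f⁆ = h)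
    (hθe : θ e = ζ • e) (hθh : θ h = h) (hθf : θ f = ζ⁻¹ • f)
    (hen : IsNilpotent (LieAlgebra.ad k g e))
    (her : Module.finrank k (zc k g e) = LieAlgebra.rank k g)
    : (m : ℤ) * Module.finrank k (gradePiece k g ζ θ (0 : ZMod m))
      = (Module.finrank k g : ℤ)
        + ∑ i ∈ Finset.range m, ((m : ℤ) - 1 - 2 * (i : ℤ)) * (kNum k g m e h (i : ZMod m) : ℤ) := by
  have hV := wtV_internal k g hhe hhf hef hen
  obtain ⟨M, π, hG⟩ := exists_grData k (wtV k g h) hV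
  have hζ0 : ζ ≠ 0 := hζ.ne_zero (by omega)
  have hr := rank_le_fixed k g hG m hm θ hθb hθm hθh hθinner
  have hr0 := hr.trans (Submodule.finrank_mono inf_le_right)
  obtain ⟨s0, s1, s2, s3⟩ := wtV_struct k g hhe hG her hr0
  have hfix : ∀ x ∈ wtV k g h 0, θ x = x := by
    have h1 : LinearMap.ker ((θ : g →ₗ[k] g) - 1) ⊓ wtV k g h 0 = wtV k g h 0 :=
      Submodule.eq_of_le_of_finrank_le inf_le_right (by omega)
    intro x hx
    rw [← h1] at hx
    exact sub_eq_zero.1 (LinearMap.mem_ker.1 hx.1)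
  have hodd := wtV_odd k g hhe s1 s2 s3
  have hzeta := wtV_zeta k g hhe hζ0 θ hθb hθh hθe hfix s2 s3
  have hE := hG.even k g hodd
  have hsymm : ∀ j, finrank k (wtV k g h (-j)) = finrank k (wtV k g h j) := by
    intro j
    refine le_antisymm ?_ (wtV_symm k g hV hG j)
    have := wtV_symm k g hV hG (-j)
    rwa [neg_neg] at this
  have hfc := final_count m hm M (fun c => (finrank k (wtV k g h (2 * c)) : ℤ))
    (fun c => (finrank k ↥(LinearMap.ker (ad k g e) ⊓ wtV k g h (2 * c)) : ℤ))
    (by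
      have := hE.bot (M + 1) (by rw [Finset.mem_Icc]; omega)
      rw [this, finrank_bot, Nat.cast_zero])
    (fun c => by rw [mul_neg, hsymm])
    (fun c hc => by rw [s2 (2 * c) (by omega), finrank_bot, Nat.cast_zero])
    (fun c hc => by
      have := rank_nullity_on k g (ad k g e) (wtV k g h (2 * c))
      rw [s3 _ (by omega)] at this
      rw [mul_add, mul_one]
      exact_mod_cast this)
  -- the fixed space
  have hg0 : finrank k (gradePiece k g ζ θ (0 : ZMod m)) =
      ∑ c ∈ Finset.Icc (-(M : ℤ)) M, (if (m : ℤ) ∣ c then finrank k (wtV k g h (2 * c)) else 0) := by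
    have h1 : gradePiece k g ζ θ (0 : ZMod m) = LinearMap.ker ((θ : g →ₗ[k] g) - 1) := by
      ext x
      rw [gradePiece, Module.End.mem_eigenspace_iff, ZMod.val_zero, pow_zero, one_smul,
        LinearMap.mem_ker, LinearMap.sub_apply, sub_eq_zero, Module.End.one_apply]
    rw [h1, hE.finrank_ker k ((θ : g →ₗ[k] g) - 1) 0]
    · refine Finset.sum_congr rfl fun c _ => ?_
      split_ifs with hc
      · rw [inf_eq_right.2]
        intro x hx
        rw [LinearMap.mem_ker, LinearMap.sub_apply, sub_eq_zero, Module.End.one_apply,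
          LinearEquiv.coe_coe, hzeta c x hx, (hζ.zpow_eq_one_iff_dvd c).2 hc, one_smul]
      · rw [Submodule.finrank_eq_zero, eq_bot_iff]
        rintro x ⟨hx1, hx⟩
        have hx2 : θ x - x = 0 := LinearMap.mem_ker.1 hx1
        rw [hzeta c x hx] at hx2
        have hx3 : (ζ ^ c - 1) • x = 0 := by rw [sub_smul, one_smul, hx2]
        rw [smul_eq_zero, sub_eq_zero, hζ.zpow_eq_one_iff_dvd c] at hx3
        exact hx3.resolve_left hc
    · intro j x hx
      simp only [add_zero] at hx ⊢
      exact Submodule.sub_mem _ (wtV_theta k g θ hθb hθh _ x hx) hx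
  have hk : ∀ i : ZMod m, (kNum k g m e h i : ℤ) = ∑ c ∈ Finset.Icc (-(M : ℤ)) M,
      (if (c : ZMod m) = i then
        (finrank k ↥(LinearMap.ker (ad k g e) ⊓ wtV k g h (2 * c)) : ℤ) else 0) := by
    intro i
    have heq : ∀ c : ℤ, (ad k g h).eigenspace (2 * (c : k)) = wtV k g h (2 * c) := by
      intro c
      rw [wtV_eq_eigenspace k g s0]
      congr 1
      push_cast; rfl
    have hkn : kNum k g m e h i = ∑ᶠ c : ℤ, if (c : ZMod m) = i then
        finrank k ↥(LinearMap.ker (ad k g e) ⊓ wtV k g h (2 * c)) else 0 := by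
      unfold kNum zc
      refine finsum_congr fun c => ?_
      rw [heq c]
    rw [hkn, finsum_eq_sum_of_support_subset (s := Finset.Icc (-(M : ℤ)) M)]
    · push_cast
      rfl
    · intro c hc
      by_contra hcM
      apply hc
      have := hE.bot c hcM
      beta_reduce
      rw [this, inf_bot_eq, finrank_bot, ite_self]
  have htop := hE.finrank_top k
  rw [hg0, htop]
  push_cast
  rw [hfc]
  congr 1
  simp only [hk, Finset.mul_sum]
  rw [Finset.sum_comm]
  refine Finset.sum_congr rfl fun c _ => ?_
  rw [← phi_sum m hm c, Finset.sum_mul]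
  refine Finset.sum_congr rfl fun i _ => ?_
  split_ifs <;> simp
end

section
/- Suppose θ is inner of order m. Let F be an Int g-invariant polynomial function on g that is homogeneous of degree d. If F does not vanish identically on g_1, then m divides d. -/
open LieAlgebra Module

variable (k : Type*) [Field k] [IsAlgClosed k] [CharZero k]
variable (g : Type*) [LieRing g] [LieAlgebra k g] [FiniteDimensional k g]
  [LieAlgebra.IsSemisimple k g]

theorem dvd_degree_of_not_vanishing
    (m : ℕ) (hm : 1 ≤ m) (ζ : k) (hζ : IsPrimitiveRoot ζ m)
    (θ : g ≃ₗ[k] g) (hθb : ∀ x y : g, θ ⁅x, y⁆ = ⁅θ x, θ y⁆)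
    (hord : orderOf θ = m) (hθinner : θ ∈ IntG k g)
    (F : g → k) (hF : IsPolyFun k g F)
    (hinv : ∀ τ ∈ IntG k g, ∀ x : g, F (τ x) = F x)
    (d : ℕ) (hhom : ∀ t : k, ∀ x : g, F (t • x) = t ^ d * F x)
    (hne : ∃ x ∈ gradePiece k g ζ θ (1 : ZMod m), F x ≠ 0) :
    m ∣ d := by
  obtain ⟨x, hx, hFx⟩ := hne
  rcases Nat.lt_or_ge 1 m with h1 | h1
  · have hv : (1 : ZMod m).val = 1 := by
      haveI : Fact (1 < m) := ⟨h1⟩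
      exact ZMod.val_one m
    have hθx : θ x = ζ • x := by
      have h := Module.End.mem_eigenspace_iff.mp hx
      rw [hv, pow_one] at h
      exact h
    have h := hinv θ hθinner x
    rw [hθx, hhom] at h
    exact hζ.dvd_of_pow_eq_one d (mul_right_cancel₀ hFx (by rw [h, one_mul]))
  · have : m = 1 := le_antisymm h1 hm
    rw [this]
    exact one_dvd d
end

section
/- Suppose the grading is S-regular, and let x ∈ g_1 be a regular semisimple element of g. Then for every k ∈ ℤ/mℤ, dim g_k − dim (z(x) ∩ g_k) = (dim g − rank g)/m. In particular, m divides dim g − rank g. -/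
open LieAlgebra Module

variable (k : Type*) [Field k] [IsAlgClosed k] [CharZero k]
variable (g : Type*) [LieRing g] [LieAlgebra k g] [FiniteDimensional k g]
  [LieAlgebra.IsSemisimple k g]

lemma zeta_pow_add_val {k : Type*} [Field k] {m : ℕ} [NeZero m] {ζ : k} (hζ : ζ ^ m = 1)
    (a b : ZMod m) : ζ ^ (a + b).val = ζ ^ a.val * ζ ^ b.val := by
  rw [ZMod.val_add, ← pow_add, ← pow_eq_pow_mod _ hζ]

lemma const_of_le_succ {m : ℕ} [NeZero m] (d : ZMod m → ℕ) (h : ∀ i, d i ≤ d (i + 1))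
    (i j : ZMod m) : d i = d j := by
  have key : ∀ (n : ℕ) (i : ZMod m), d i ≤ d (i + n) := by
    intro n
    induction n with
    | zero => intro i; simp
    | succ n ih =>
      intro i
      refine (ih i).trans ((h _).trans (le_of_eq ?_))
      congr 1; push_cast; ring
  have key2 : ∀ i j : ZMod m, d i ≤ d j := by
    intro i j
    have := key (j - i).val i
    rwa [ZMod.natCast_val, ZMod.cast_id, add_sub_cancel] at this
  exact le_antisymm (key2 i j) (key2 j i)

theorem sRegular_dim_formula
    (m : ℕ) (hm : 1 ≤ m) (ζ : k) (hζ : IsPrimitiveRoot ζ m)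
    (θ : g ≃ₗ[k] g) (hθb : ∀ x y : g, θ ⁅x, y⁆ = ⁅θ x, θ y⁆) (hθm : θ ^ m = 1)
    (x : g) (hx : x ∈ gradePiece k g ζ θ (1 : ZMod m))
    (hss : (LieAlgebra.ad k g x).IsSemisimple)
    (hreg : Module.finrank k (zc k g x) = LieAlgebra.rank k g) :
    ((m : ℤ) ∣ (Module.finrank k g : ℤ) - LieAlgebra.rank k g) ∧
    ∀ i : ZMod m, (m : ℤ) * ((Module.finrank k (gradePiece k g ζ θ i) : ℤ)
        - Module.finrank k ↥(zc k g x ⊓ gradePiece k g ζ θ i))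
      = (Module.finrank k g : ℤ) - LieAlgebra.rank k g := by
  have : NeZero m := ⟨by omega⟩
  set A : Module.End k g := LieAlgebra.ad k g x with hA
  set G : ZMod m → Submodule k g := fun i => gradePiece k g ζ θ i with hG
  have hGdef : ∀ i y, y ∈ G i ↔ θ y = ζ ^ i.val • y := by
    intro i y
    simp [hG, gradePiece, Module.End.mem_eigenspace_iff]
  have hAG : ∀ i, ∀ y ∈ G i, A y ∈ G (i + 1) := by
    intro i y hy
    rw [hGdef] at hy ⊢
    have hx' : θ x = _ := (hGdef 1 x).1 hx
    rw [hA, LieAlgebra.ad_apply, hθb, hy, hx', zeta_pow_add_val hζ.pow_eq_one]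
    simp [smul_smul, mul_comm]
  have hker2 : ∀ y, A (A y) = 0 → A y = 0 := by
    intro y hy
    have h1 := hss.isFinitelySemisimple.genEigenspace_eq_eigenspace (μ := 0) (k := 2) (by norm_num)
    have h2 : y ∈ A.genEigenspace 0 2 := by
      rw [show (2 : ℕ∞) = ((2 : ℕ) : ℕ∞) from rfl, Module.End.mem_genEigenspace_nat]
      simp [pow_two, hy]
    rw [h1, Module.End.mem_eigenspace_iff] at h2
    simpa using h2
  have hinj : Function.Injective (fun i : ZMod m => ζ ^ i.val) := by
    intro a b hab
    exact ZMod.val_injective m (hζ.pow_inj (ZMod.val_lt a) (ZMod.val_lt b) hab)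
  have hind : iSupIndep G := (Module.End.eigenspaces_iSupIndep (θ : Module.End k g)).comp hinj
  have hpow : (θ : Module.End k g) ^ m = 1 := by
    have := congrArg (fun t : g ≃ₗ[k] g => (t : Module.End k g)) hθm
    ext y
    have h2 := congrArg (fun t : g ≃ₗ[k] g => t y) hθm
    simp only [LinearEquiv.pow_apply] at h2
    simpa [Module.End.pow_apply] using h2
  have htop : ⨆ i, G i = ⊤ := by
    have hs : Module.End.IsSemisimple (θ : Module.End k g) := by
      apply Module.End.isSemisimple_of_squarefree_aeval_eq_zero (p := Polynomial.X ^ m - 1)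
      · exact ((Polynomial.separable_X_pow_sub_C (1 : k) (n := m)
          (by exact_mod_cast (NeZero.ne m)) one_ne_zero)).squarefree
      · simp [hpow]
    rw [eq_top_iff, ← Module.End.iSup_maxGenEigenspace_eq_top (θ : Module.End k g)]
    refine iSup_le fun μ => ?_
    rw [hs.isFinitelySemisimple.maxGenEigenspace_eq_eigenspace]
    intro y hy
    by_cases hy0 : y = 0
    · simp [hy0]
    have hyv : Module.End.HasEigenvector (θ : Module.End k g) μ y := ⟨hy, hy0⟩
    have h1 := hyv.pow_apply m
    rw [hpow] at h1
    have hμ : μ ^ m = 1 := by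
      have : (μ ^ m - 1) • y = 0 := by rw [sub_smul, ← h1]; simp
      exact sub_eq_zero.1 ((smul_eq_zero.1 this).resolve_right hy0)
    obtain ⟨n, hn, rfl⟩ := hζ.eq_pow_of_pow_eq_one hμ
    refine Submodule.mem_iSup_of_mem (n : ZMod m) ?_
    rw [hGdef, ZMod.val_natCast_of_lt hn]
    exact Module.End.mem_eigenspace_iff.1 hy
  have hle : ∀ i, (G i).map A ≤ G (i + 1) := by
    rintro i _ ⟨y, hy, rfl⟩
    exact hAG i y hy
  have hrn : ∀ i, finrank k ((G i).map A) + finrank k ↥(zc k g x ⊓ G i) = finrank k (G i) := by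
    intro i
    have h := LinearMap.finrank_range_add_finrank_ker (A.domRestrict (G i))
    rw [LinearMap.range_domRestrict, LinearMap.ker_domRestrict] at h
    rw [← h, ← Submodule.finrank_map_subtype_eq (G i), Submodule.map_comap_subtype, inf_comm]
    rfl
  have hmono : ∀ i, finrank k ((G i).map A) ≤ finrank k ((G (i + 1)).map A) := by
    intro i
    have h := LinearMap.finrank_range_of_inj (f := A.domRestrict ((G i).map A)) (by
      rw [← LinearMap.ker_eq_bot, LinearMap.ker_eq_bot']
      rintro ⟨_, y, hy, rfl⟩ h
      ext
      exact hker2 y h)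
    rw [LinearMap.range_domRestrict] at h
    rw [← h]
    exact Submodule.finrank_mono (Submodule.map_mono (hle i))
  have hconst := const_of_le_succ _ hmono
  have hsum : ∑ i, finrank k ((G i).map A) = finrank k (LinearMap.range A) := by
    have hi : iSupIndep (fun i => (G i).map A) :=
      (hind.comp (add_left_injective (1 : ZMod m))).mono hle
    have hr : LinearMap.range A = ⨆ i, (G i).map A := by
      rw [← Submodule.map_iSup, htop, Submodule.map_top]
    rw [hr]
    rw [Submodule.iSup_eq_range_dfinsupp_lsum,
      LinearMap.finrank_range_of_inj hi.dfinsupp_lsum_injective]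
    exact (Module.finrank_directSum (R := k) (fun i => ↥((G i).map A))).symm
  have hrk := LinearMap.finrank_range_add_finrank_ker A
  have hmain : ∀ i : ZMod m, (m : ℤ) * ((finrank k (G i) : ℤ) - finrank k ↥(zc k g x ⊓ G i))
      = (finrank k g : ℤ) - LieAlgebra.rank k g := by
    intro i
    have h1 : ∑ j, finrank k ((G j).map A) = m * finrank k ((G i).map A) := by
      rw [Finset.sum_congr rfl (fun j _ => hconst j i)]
      simp [ZMod.card]
    have h2 : finrank k (LinearMap.ker A) = LieAlgebra.rank k g := hreg
    rw [← hrn i, ← hrk, ← h2, ← hsum, h1]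
    push_cast
    ring
  exact ⟨⟨_, (hmain 0).symm⟩, hmain⟩
end
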